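/- Let U and V be nonlocal vertex algebras and R(x) an invertible twisting operator for (U,V). Let W be a vector space equipped with a U-module structure (W, Y_W^U) and a V-module structure (W, Y_W^V) such that for all u ∈ U, v ∈ V: (1) Y_W^U(u,x₁)Y_W^V(v,x₂) ∈ Hom(W, W((x₁,x₂))); (2) Y_W^U(u,x₁)Y_W^V(v,x₂)w = Y_W^U(x₂)(1⊗Y_W^V(x₁))(R⁻¹)¹²(x₂−x₁)(u⊗v⊗w) for every w ∈ W; and (3) there exists a nonnegative integer k with (x₂−x₁)^k Y_W^V(v,x₁)Y_W^U(u,x₂)w = (x₂−x₁)^k Y_W^U(x₂)(1⊗Y_W^V(x₁))R¹²(x₂−x₁)(v⊗u⊗w) for every w ∈ W. Then there exists a U⊗_R V-module structure Y_R^W on W extending both Y_W^U and Y_W^V, and it is unique. -/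

import Mathlib

open scoped TensorProduct BigOperators

noncomputable section

/-- Integer binomial coefficient `C(n, k)` for `n : ℤ`, `k : ℕ`. -/
def zchoose (n : ℤ) (k : ℕ) : ℤ :=
  if 0 ≤ n then ((n.toNat).choose k : ℤ)
  else (-1) ^ k * ((((k : ℤ) - n - 1).toNat).choose k)

section Series

variable {V : Type*} [AddCommGroup V] [Module ℂ V]

/-- `a` is (the coefficient family of) an element of `V((x))`. -/
def IsLaurent (a : ℤ → V) : Prop := ∃ N : ℤ, ∀ n : ℤ, n < N → a n = 0

/-- `a` is an element of `V[[x]]`. -/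
def IsPowerSeries (a : ℤ → V) : Prop := ∀ n : ℤ, n < 0 → a n = 0

/-- `A` is an element of `V((x₁, x₂))` (first index: exponent of `x₁`). -/
def IsLaurent2 (A : ℤ → ℤ → V) : Prop :=
  ∃ N : ℤ, ∀ m n : ℤ, (m < N ∨ n < N) → A m n = 0

/-- `a` is an element of `V ⊗ ℂ((x)) ⊆ V((x))`: truncated below, with coefficients
lying in a finitely generated (i.e. finite dimensional) subspace. -/
def IsTensorLaurent (a : ℤ → V) : Prop :=
  IsLaurent a ∧ ∃ F : Submodule ℂ V, F.FG ∧ ∀ n, a n ∈ F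

/-- Multiply the double series `A(x₁,x₂)` by `(x₁+x₂)^k`. -/
def mulAddPow (k : ℕ) (A : ℤ → ℤ → V) : ℤ → ℤ → V := fun a b =>
  ∑ j ∈ Finset.range (k + 1), ((k.choose j : ℕ) : ℂ) • A (a - (k : ℤ) + j) (b - j)

/-- Multiply the double series `A(x₁,x₂)` by `(x₁-x₂)^k`. -/
def mulSubPow (k : ℕ) (A : ℤ → ℤ → V) : ℤ → ℤ → V := fun a b =>
  ∑ j ∈ Finset.range (k + 1),
    ((-1 : ℂ) ^ j * ((k.choose j : ℕ) : ℂ)) • A (a - (k : ℤ) + j) (b - j)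

/-- Multiply the double series `A(x₁,x₂)` by `(x₂-x₁)^k`. -/
def mulSubPow' (k : ℕ) (A : ℤ → ℤ → V) : ℤ → ℤ → V := fun a b =>
  ∑ j ∈ Finset.range (k + 1),
    ((-1 : ℂ) ^ j * ((k.choose j : ℕ) : ℂ)) • A (a - j) (b - (k : ℤ) + j)

/-- Substitute `x₁ = x₀ + x₂` in `A(x₁,x₂)`, expanding in nonnegative powers of `x₂`.
The result is indexed by (exponent of `x₀`, exponent of `x₂`). -/
def substAdd02 (A : ℤ → ℤ → V) : ℤ → ℤ → V := fun a b =>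
  ∑ᶠ i : ℕ, ((zchoose (a + i) i : ℤ) : ℂ) • A (a + i) (b - i)

/-- Substitute `x₁ = x₂ + x₀` in `A(x₁,x₂)`, expanding in nonnegative powers of `x₀`.
The result is indexed by (exponent of `x₀`, exponent of `x₂`). -/
def substAdd20 (A : ℤ → ℤ → V) : ℤ → ℤ → V := fun a b =>
  if 0 ≤ a then ∑ᶠ m : ℤ, ((zchoose m a.toNat : ℤ) : ℂ) • A m (b - m + a) else 0

/-- Multiply the double series `A(x₁,x₂)` by `f(x₂ - x₁)`, expanded in nonnegative
powers of `x₁`. -/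
def scalarMulSub (f : ℤ → ℂ) (A : ℤ → ℤ → V) : ℤ → ℤ → V := fun m n =>
  ∑ᶠ (i : ℕ) (p : ℤ),
    ((-1 : ℂ) ^ i * ((zchoose p i : ℤ) : ℂ) * f p) • A (m - i) (n - p + i)

/-- Multiply a double series by a polynomial in two variables. -/
def polyMul2 (p : MvPolynomial (Fin 2) ℂ) (A : ℤ → ℤ → V) : ℤ → ℤ → V := fun m n =>
  ∑ d ∈ p.support, MvPolynomial.coeff d p • A (m - (d 0 : ℤ)) (n - (d 1 : ℤ))

/-- The relation `A ∼ B`: `p·A = p·B` for some nonzero polynomial `p(x₁,x₂)`. -/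
def SimEq2 (A B : ℤ → ℤ → V) : Prop :=
  ∃ p : MvPolynomial (Fin 2) ℂ, p ≠ 0 ∧ ∀ m n : ℤ, polyMul2 p A m n = polyMul2 p B m n

/-- `a` is an element of the iterated Laurent series space `V((x₁))⋯((x_n))`. -/
def IsIterLaurent : (n : ℕ) → ((Fin n → ℤ) → V) → Prop
  | 0, _ => True
  | n + 1, a =>
      (∃ N : ℤ, ∀ k : Fin (n + 1) → ℤ, k (Fin.last n) < N → a k = 0) ∧
      ∀ m : ℤ, IsIterLaurent n fun k => a (Fin.snoc k m)

end Series

/-- A nonlocal vertex algebra over `ℂ`, with `Y u v n` the coefficient of `x^n`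
in `Y(u,x)v` (so `u_m v = Y u v (-m-1)`). -/
structure NLVA (V : Type*) [AddCommGroup V] [Module ℂ V] where
  Y : V →ₗ[ℂ] V →ₗ[ℂ] (ℤ → V)
  one : V
  trunc : ∀ u v : V, IsLaurent (Y u v)
  vacuum_left : ∀ (v : V) (n : ℤ), Y one v n = if n = 0 then v else 0
  creation_reg : ∀ v : V, IsPowerSeries (Y v one)
  creation_zero : ∀ v : V, Y v one 0 = v
  weak_assoc : ∀ u v w : V, ∃ k : ℕ, ∀ a b : ℤ,
    mulAddPow k (substAdd02 fun m n => Y u (Y v w n) m) a b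
      = mulAddPow k (fun a' b' => Y (Y u v a') w b') a b

namespace NLVA

variable {U V K : Type*} [AddCommGroup U] [Module ℂ U] [AddCommGroup V] [Module ℂ V]
  [AddCommGroup K] [Module ℂ K]

/-- The coefficient `Y(·)_n(·)` as a bilinear map. -/
def Yc (𝒱 : NLVA V) (n : ℤ) : V →ₗ[ℂ] V →ₗ[ℂ] V :=
  𝒱.Y.compr₂ (LinearMap.proj n)

/-- The operator `D(v) = v_{-2}𝟙`, i.e. the coefficient of `x^1` in `Y(v,x)𝟙`. -/
def D (𝒱 : NLVA V) : V →ₗ[ℂ] V :=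
  (LinearMap.proj (1 : ℤ)).comp (𝒱.Y.flip 𝒱.one)

/-- Homomorphisms of nonlocal vertex algebras. -/
def IsHom (𝒰 : NLVA U) (𝒱 : NLVA V) (f : U →ₗ[ℂ] V) : Prop :=
  f 𝒰.one = 𝒱.one ∧ ∀ (a b : U) (n : ℤ), f (𝒰.Y a b n) = 𝒱.Y (f a) (f b) n

/-- `𝒦` is generated, as a nonlocal vertex algebra, by the subset `S`. -/
def IsGeneratedBy (𝒦 : NLVA K) (S : Set K) : Prop :=
  ∀ P : Submodule ℂ K, 𝒦.one ∈ P →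
    (∀ a ∈ P, ∀ b ∈ P, ∀ n : ℤ, 𝒦.Y a b n ∈ P) → S ⊆ P → P = ⊤

/-- `𝒰` is irreducible as a module over itself. -/
def SelfIrreducible (𝒰 : NLVA U) : Prop :=
  Nontrivial U ∧
    ∀ P : Submodule ℂ U, (∀ u : U, ∀ p ∈ P, ∀ n : ℤ, 𝒰.Y u p n ∈ P) → P = ⊥ ∨ P = ⊤

/-- The coefficients of the product `Y(v₁,x₁)⋯Y(v_n,x_n)𝟙`. -/
def prodY (𝒱 : NLVA V) : (n : ℕ) → (Fin n → V) → (Fin n → ℤ) → V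
  | 0, _, _ => 𝒱.one
  | n + 1, v, k => 𝒱.Y (v 0) (prodY 𝒱 n (fun i => v i.succ) fun i => k i.succ) (k 0)

/-- Non-degeneracy in the sense of Etingof–Kazhdan: the maps
`Z_n : V^{⊗n} ⊗ ℂ((x₁))⋯((x_n)) → V((x₁))⋯((x_n))` are injective. -/
def NonDegenerate (𝒱 : NLVA V) : Prop :=
  ∀ n : ℕ, 0 < n → ∀ (r : ℕ) (v : Fin r → Fin n → V) (f : Fin r → (Fin n → ℤ) → ℂ),
    (∀ j, IsIterLaurent n (f j)) →
    LinearIndependent ℂ (fun j : Fin r => PiTensorProduct.tprod ℂ (v j)) →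
    (∀ K' : Fin n → ℤ,
      (∑ j : Fin r, ∑ᶠ L : Fin n → ℤ,
        f j L • 𝒱.prodY n (v j) fun i => K' i - L i) = 0) →
    ∀ j, f j = 0

end NLVA

/-- Countable dimension over `ℂ`. -/
def CountableDim (U : Type*) [AddCommGroup U] [Module ℂ U] : Prop :=
  ∃ s : Set U, s.Countable ∧ Submodule.span ℂ s = ⊤

/-- `𝒱` satisfies `𝒮`-locality, i.e. is a weak quantum vertex algebra. -/
def SLocal {V : Type*} [AddCommGroup V] [Module ℂ V] (𝒱 : NLVA V) : Prop :=
  ∀ u v : V, ∃ (r : ℕ) (uu vv : Fin r → V) (f : Fin r → ℤ → ℂ) (k : ℕ),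
    (∀ i, IsLaurent (f i)) ∧ ∀ (w : V) (m n : ℤ),
      mulSubPow k (fun a b => 𝒱.Y u (𝒱.Y v w b) a) m n
        = mulSubPow k (fun a b => ∑ i, scalarMulSub (f i)
            (fun a' b' => 𝒱.Y (vv i) (𝒱.Y (uu i) w a') b') a b) m n

/-- A module for a nonlocal vertex algebra. -/
structure NLVAModule {V : Type*} [AddCommGroup V] [Module ℂ V] (𝒱 : NLVA V)
    (W : Type*) [AddCommGroup W] [Module ℂ W] where
  Yw : V →ₗ[ℂ] W →ₗ[ℂ] (ℤ → W)
  trunc : ∀ (v : V) (w : W), IsLaurent (Yw v w)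
  vacuum : ∀ (w : W) (n : ℤ), Yw 𝒱.one w n = if n = 0 then w else 0
  weak_assoc : ∀ (u v : V) (w : W), ∃ k : ℕ, ∀ a b : ℤ,
    mulAddPow k (substAdd02 fun m n => Yw u (Yw v w n) m) a b
      = mulAddPow k (fun a' b' => Yw (𝒱.Y u v a') w b') a b

section Twist

variable {U V : Type*} [AddCommGroup U] [Module ℂ U] [AddCommGroup V] [Module ℂ V]

/-- Coefficient of `x₁^m x₂^n` in `(Y(x₂)⊗1)R²³(x₁)R¹²(x₁+x₂)` applied to `v ⊗ u ⊗ u'`. -/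
def hex1RHS (𝒰 : NLVA U) (Rc : ℤ → (V ⊗[ℂ] U →ₗ[ℂ] U ⊗[ℂ] V))
    (v : V) (u u' : U) (m n : ℤ) : U ⊗[ℂ] V :=
  ∑ᶠ (i : ℕ) (c : ℤ),
    ((zchoose (m - c + i) i : ℤ) : ℂ) •
      (TensorProduct.map (TensorProduct.lift (𝒰.Yc (n - i))) LinearMap.id)
        ((TensorProduct.assoc ℂ U U V).symm
          ((LinearMap.lTensor U (Rc c))
            ((TensorProduct.assoc ℂ U V U)
              ((Rc (m - c + i) (v ⊗ₜ u)) ⊗ₜ u'))))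

/-- Coefficient of `x₁^m x₂^n` in `(1⊗Y(x₂))R¹²(x₁-x₂)R²³(x₁)` applied to `v ⊗ v' ⊗ u`. -/
def hex2RHS (𝒱 : NLVA V) (Rc : ℤ → (V ⊗[ℂ] U →ₗ[ℂ] U ⊗[ℂ] V))
    (v v' : V) (u : U) (m n : ℤ) : U ⊗[ℂ] V :=
  ∑ᶠ (i : ℕ) (c : ℤ),
    ((-1 : ℂ) ^ i * ((zchoose (m - c + i) i : ℤ) : ℂ)) •
      (LinearMap.lTensor U (TensorProduct.lift (𝒱.Yc (n - i))))
        ((TensorProduct.assoc ℂ U V V)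
          ((TensorProduct.map (Rc (m - c + i)) LinearMap.id)
            ((TensorProduct.assoc ℂ V U V).symm
              (v ⊗ₜ (Rc c (v' ⊗ₜ u))))))

/-- A twisting operator `R(x) : V ⊗ U → U ⊗ V ⊗ ℂ((x))` for the ordered pair `(U,V)`,
given by its family of coefficients `Rc n`. -/
structure TwistingOp (𝒰 : NLVA U) (𝒱 : NLVA V) where
  Rc : ℤ → (V ⊗[ℂ] U →ₗ[ℂ] U ⊗[ℂ] V)
  laurent : ∀ t : V ⊗[ℂ] U, IsTensorLaurent fun n => Rc n t
  vac_right : ∀ (v : V) (n : ℤ),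
    Rc n (v ⊗ₜ 𝒰.one) = if n = 0 then 𝒰.one ⊗ₜ v else 0
  vac_left : ∀ (u : U) (n : ℤ),
    Rc n (𝒱.one ⊗ₜ u) = if n = 0 then u ⊗ₜ 𝒱.one else 0
  hex1 : ∀ (v : V) (u u' : U) (m n : ℤ),
    Rc m (v ⊗ₜ (𝒰.Y u u' n)) = hex1RHS 𝒰 Rc v u u' m n
  hex2 : ∀ (v v' : V) (u : U) (m n : ℤ),
    Rc m ((𝒱.Y v v' n) ⊗ₜ u) = hex2RHS 𝒱 Rc v v' u m n

/-- `Sc` is a two-sided inverse of `Rc` as `ℂ((x))`-linear maps (coefficientwise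
convolution), with values in the tensor with `ℂ((x))`. -/
def IsInvPair {A B : Type*} [AddCommGroup A] [Module ℂ A] [AddCommGroup B] [Module ℂ B]
    (Rc : ℤ → (A →ₗ[ℂ] B)) (Sc : ℤ → (B →ₗ[ℂ] A)) : Prop :=
  (∀ t : B, IsTensorLaurent fun n => Sc n t) ∧
  (∀ (t : A) (n : ℤ), (∑ᶠ c : ℤ, Sc c (Rc (n - c) t)) = if n = 0 then t else 0) ∧
  (∀ (t : B) (n : ℤ), (∑ᶠ c : ℤ, Rc c (Sc (n - c) t)) = if n = 0 then t else 0)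

/-- The canonical embedding `u ↦ u ⊗ 𝟙`. -/
def iotaU (𝒱 : NLVA V) : U →ₗ[ℂ] U ⊗[ℂ] V := (TensorProduct.mk ℂ U V).flip 𝒱.one

/-- The canonical embedding `v ↦ 𝟙 ⊗ v`. -/
def iotaV (𝒰 : NLVA U) : V →ₗ[ℂ] U ⊗[ℂ] V := TensorProduct.mk ℂ U V 𝒰.one

/-- The operator `D ⊗ 1 + 1 ⊗ D` on `U ⊗ V`. -/
def DUV (𝒰 : NLVA U) (𝒱 : NLVA V) : U ⊗[ℂ] V →ₗ[ℂ] U ⊗[ℂ] V :=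
  LinearMap.rTensor V 𝒰.D + LinearMap.lTensor U 𝒱.D

/-- The coefficient of `x^n` in `Y_R(u⊗v, x)(u'⊗v') = (Y(x)⊗Y(x))R²³(-x)(u⊗v⊗u'⊗v')`. -/
def YRcoef (𝒰 : NLVA U) (𝒱 : NLVA V) (Rop : TwistingOp 𝒰 𝒱)
    (u : U) (v : V) (u' : U) (v' : V) (n : ℤ) : U ⊗[ℂ] V :=
  ∑ᶠ (c : ℤ) (a : ℤ),
    ((-1 : ℂ) ^ c) •
      (TensorProduct.map (𝒰.Yc a u) ((𝒱.Yc (n - c - a)).flip v'))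
        (Rop.Rc c (v ⊗ₜ u'))

/-- `𝒯` is the twisted tensor product nonlocal vertex algebra `U ⊗_R V`. -/
def IsTwistedTensor (𝒰 : NLVA U) (𝒱 : NLVA V) (Rop : TwistingOp 𝒰 𝒱)
    (𝒯 : NLVA (U ⊗[ℂ] V)) : Prop :=
  𝒯.one = 𝒰.one ⊗ₜ 𝒱.one ∧
  ∀ (u u' : U) (v v' : V) (n : ℤ),
    𝒯.Y (u ⊗ₜ v) (u' ⊗ₜ v') n = YRcoef 𝒰 𝒱 Rop u v u' v' n

end Twist

section Aux

variable {A B W T : Type*} [AddCommGroup A] [Module ℂ A] [AddCommGroup B] [Module ℂ B]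
  [AddCommGroup W] [Module ℂ W] [AddCommGroup T] [Module ℂ T]

/-- The linear map `(a ⊗ b) ↦ Y_A(a)_e (Y_B(b)_j w)`, i.e. the coefficient
of `Y_A(x₂)(1 ⊗ Y_B(x₁)) (· ⊗ · ⊗ w)` at `x₂^e x₁^j`. -/
def sandwichMod (YA : A →ₗ[ℂ] W →ₗ[ℂ] (ℤ → W)) (YB : B →ₗ[ℂ] W →ₗ[ℂ] (ℤ → W))
    (w : W) (e j : ℤ) : A ⊗[ℂ] B →ₗ[ℂ] W :=
  TensorProduct.lift
    ((YA.compr₂ (LinearMap.proj e)).compl₂ ((YB.compr₂ (LinearMap.proj j)).flip w))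

/-- Coefficient of `x₁^m x₂^n` in `Y_A(x₂)(1 ⊗ Y_B(x₁)) q(x₂ - x₁) (⋯ ⊗ w)`, where the
series `q` is evaluated at `x₂ - x₁`, expanded in nonnegative powers of `x₁`. -/
def twistRHS (YA : A →ₗ[ℂ] W →ₗ[ℂ] (ℤ → W)) (YB : B →ₗ[ℂ] W →ₗ[ℂ] (ℤ → W))
    (q : ℤ → A ⊗[ℂ] B) (w : W) : ℤ → ℤ → W := fun m n =>
  ∑ᶠ (i : ℕ) (p : ℤ),
    ((-1 : ℂ) ^ i * ((zchoose p i : ℤ) : ℂ)) •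
      sandwichMod YA YB w (n - p + i) (m - i) (q p)

/-- As `twistRHS`, but with `q` evaluated at `-x₂ + x₁`, expanded in nonnegative
powers of `x₂`. -/
def twistRHSalt (YA : A →ₗ[ℂ] W →ₗ[ℂ] (ℤ → W)) (YB : B →ₗ[ℂ] W →ₗ[ℂ] (ℤ → W))
    (q : ℤ → A ⊗[ℂ] B) (w : W) : ℤ → ℤ → W := fun m n =>
  ∑ᶠ (i : ℕ) (p : ℤ),
    ((-1 : ℂ) ^ i * ((zchoose p i : ℤ) : ℂ)) •
      sandwichMod YA YB w (n - i) (m - p + i) (q p)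

/-- Coefficient of `x^n` in `e^{xD} F(x)` where `F` is given by its coefficients. -/
def expD (Dop : T →ₗ[ℂ] T) (F : ℤ → T) (n : ℤ) : T :=
  ∑ᶠ j : ℕ, ((j.factorial : ℂ))⁻¹ • (Dop ^ j) (F (n - j))

end Aux

section YBE

variable {V : Type*} [AddCommGroup V] [Module ℂ V]

/-- The flip of the last two tensor factors of `(V⊗V)⊗V`. -/
def swap23 : (V ⊗[ℂ] V) ⊗[ℂ] V →ₗ[ℂ] (V ⊗[ℂ] V) ⊗[ℂ] V :=
  ((TensorProduct.assoc ℂ V V V).symm.toLinearMap).comp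
    ((LinearMap.lTensor V (TensorProduct.comm ℂ V V).toLinearMap).comp
      (TensorProduct.assoc ℂ V V V).toLinearMap)

/-- `S¹²` acting on `(V⊗V)⊗V`. -/
def S12m (Sc : ℤ → (V ⊗[ℂ] V →ₗ[ℂ] V ⊗[ℂ] V)) (c : ℤ) :
    (V ⊗[ℂ] V) ⊗[ℂ] V →ₗ[ℂ] (V ⊗[ℂ] V) ⊗[ℂ] V :=
  TensorProduct.map (Sc c) LinearMap.id

/-- `S²³` acting on `(V⊗V)⊗V`. -/
def S23m (Sc : ℤ → (V ⊗[ℂ] V →ₗ[ℂ] V ⊗[ℂ] V)) (c : ℤ) :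
    (V ⊗[ℂ] V) ⊗[ℂ] V →ₗ[ℂ] (V ⊗[ℂ] V) ⊗[ℂ] V :=
  ((TensorProduct.assoc ℂ V V V).symm.toLinearMap).comp
    ((LinearMap.lTensor V (Sc c)).comp (TensorProduct.assoc ℂ V V V).toLinearMap)

/-- `S¹³` acting on `(V⊗V)⊗V`. -/
def S13m (Sc : ℤ → (V ⊗[ℂ] V →ₗ[ℂ] V ⊗[ℂ] V)) (c : ℤ) :
    (V ⊗[ℂ] V) ⊗[ℂ] V →ₗ[ℂ] (V ⊗[ℂ] V) ⊗[ℂ] V :=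
  swap23.comp ((S12m Sc c).comp swap23)

/-- `S²¹(x) = σ S(x) σ`. -/
def S21c (Sc : ℤ → (V ⊗[ℂ] V →ₗ[ℂ] V ⊗[ℂ] V)) (c : ℤ) :
    V ⊗[ℂ] V →ₗ[ℂ] V ⊗[ℂ] V :=
  ((TensorProduct.comm ℂ V V).toLinearMap).comp
    ((Sc c).comp (TensorProduct.comm ℂ V V).toLinearMap)

/-- The quantum Yang–Baxter equation
`S¹²(x)S¹³(x+z)S²³(z) = S²³(z)S¹³(x+z)S¹²(x)` (coefficient of `x^a z^b`, with
`S¹³(x+z)` expanded in nonnegative powers of `z`). -/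
def QYBE (Sc : ℤ → (V ⊗[ℂ] V →ₗ[ℂ] V ⊗[ℂ] V)) : Prop :=
  ∀ (t : (V ⊗[ℂ] V) ⊗[ℂ] V) (a b : ℤ),
    (∑ᶠ (i : ℕ) (p : ℤ), ((zchoose p i : ℤ) : ℂ) •
        S12m Sc (a - p + i) (S13m Sc p (S23m Sc (b - i) t)))
      = ∑ᶠ (i : ℕ) (p : ℤ), ((zchoose p i : ℤ) : ℂ) •
          S23m Sc (b - i) (S13m Sc p (S12m Sc (a - p + i) t))

/-- Unitarity: `S(x) S²¹(-x) = 1`. -/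
def Unitary (Sc : ℤ → (V ⊗[ℂ] V →ₗ[ℂ] V ⊗[ℂ] V)) : Prop :=
  ∀ (t : V ⊗[ℂ] V) (n : ℤ),
    (∑ᶠ c : ℤ, ((-1 : ℂ) ^ (n - c)) • Sc c (S21c Sc (n - c) t))
      = if n = 0 then t else 0

/-- `[D ⊗ 1, S(x)] = -(d/dx) S(x)`. -/
def DComm1 (𝒱 : NLVA V) (Sc : ℤ → (V ⊗[ℂ] V →ₗ[ℂ] V ⊗[ℂ] V)) : Prop :=
  ∀ (t : V ⊗[ℂ] V) (n : ℤ),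
    (LinearMap.rTensor V 𝒱.D) (Sc n t) - Sc n ((LinearMap.rTensor V 𝒱.D) t)
      = (-((n : ℂ) + 1)) • Sc (n + 1) t

/-- `Y(u,x)v = e^{xD} Y(-x) S(-x)(v⊗u)`. -/
def SkewS (𝒱 : NLVA V) (Sc : ℤ → (V ⊗[ℂ] V →ₗ[ℂ] V ⊗[ℂ] V)) : Prop :=
  ∀ (u v : V) (n : ℤ),
    𝒱.Y u v n = expD 𝒱.D (fun p => ((-1 : ℂ) ^ p) •
      ∑ᶠ c : ℤ, (TensorProduct.lift (𝒱.Yc (p - c))) (Sc c (v ⊗ₜ u))) n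

/-- `S(x₁)(Y(x₂)⊗1) = (Y(x₂)⊗1)S²³(x₁)S¹³(x₁+x₂)`. -/
def HexY1 (𝒱 : NLVA V) (Sc : ℤ → (V ⊗[ℂ] V →ₗ[ℂ] V ⊗[ℂ] V)) : Prop :=
  ∀ (t : (V ⊗[ℂ] V) ⊗[ℂ] V) (m n : ℤ),
    Sc m ((TensorProduct.map (TensorProduct.lift (𝒱.Yc n)) LinearMap.id) t)
      = ∑ᶠ (i : ℕ) (p : ℤ), ((zchoose p i : ℤ) : ℂ) •
          (TensorProduct.map (TensorProduct.lift (𝒱.Yc (n - i))) LinearMap.id)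
            (S23m Sc (m - p + i) (S13m Sc p t))

/-- `S(x₁)(1⊗Y(x₂)) = (1⊗Y(x₂))S¹²(x₁-x₂)S¹³(x₁)`. -/
def HexY2 (𝒱 : NLVA V) (Sc : ℤ → (V ⊗[ℂ] V →ₗ[ℂ] V ⊗[ℂ] V)) : Prop :=
  ∀ (t : (V ⊗[ℂ] V) ⊗[ℂ] V) (m n : ℤ),
    Sc m ((LinearMap.lTensor V (TensorProduct.lift (𝒱.Yc n)))
        ((TensorProduct.assoc ℂ V V V) t))
      = ∑ᶠ (i : ℕ) (p : ℤ), ((-1 : ℂ) ^ i * ((zchoose p i : ℤ) : ℂ)) •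
          (LinearMap.lTensor V (TensorProduct.lift (𝒱.Yc (n - i))))
            ((TensorProduct.assoc ℂ V V V)
              (S12m Sc p (S13m Sc (m - p + i) t)))

/-- A quantum vertex algebra `(V, 𝒮)`. -/
structure QVA (V : Type*) [AddCommGroup V] [Module ℂ V] where
  alg : NLVA V
  sloc : SLocal alg
  Sc : ℤ → (V ⊗[ℂ] V →ₗ[ℂ] V ⊗[ℂ] V)
  laurent : ∀ t : V ⊗[ℂ] V, IsTensorLaurent fun n => Sc n t
  qybe : QYBE Sc
  unitary : Unitary Sc
  vac : ∀ (v : V) (n : ℤ), Sc n (alg.one ⊗ₜ v) = if n = 0 then alg.one ⊗ₜ v else 0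
  dcomm : DComm1 alg Sc
  skew : SkewS alg Sc
  hex : HexY1 alg Sc

end YBE

section Bialg

variable {H : Type*} [AddCommGroup H] [Module ℂ H]

/-- A nonlocal vertex bialgebra. -/
structure NLVBialg (H : Type*) [AddCommGroup H] [Module ℂ H] where
  alg : NLVA H
  comul : H →ₗ[ℂ] H ⊗[ℂ] H
  counit : H →ₗ[ℂ] ℂ
  coassoc : ∀ h : H, (LinearMap.lTensor H comul) (comul h)
      = (TensorProduct.assoc ℂ H H H) ((LinearMap.rTensor H comul) (comul h))
  counit_comul_left : ∀ h : H,
      (TensorProduct.lid ℂ H) ((LinearMap.rTensor H counit) (comul h)) = h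
  counit_comul_right : ∀ h : H,
      (TensorProduct.rid ℂ H) ((LinearMap.lTensor H counit) (comul h)) = h
  counit_one : counit alg.one = 1
  counit_mul : ∀ (a b : H) (n : ℤ),
      counit (alg.Y a b n) = if n = 0 then counit a * counit b else 0
  comul_one : comul alg.one = alg.one ⊗ₜ alg.one
  comul_mul : ∀ (a b : H) (n : ℤ),
      comul (alg.Y a b n)
        = ∑ᶠ p : ℤ, (TensorProduct.map₂ (alg.Yc p) (alg.Yc (n - p))) (comul a) (comul b)

/-- A nonlocal vertex `H`-module-algebra. -/
structure NLVModAlg (𝓗 : NLVBialg H) (U : Type*) [AddCommGroup U] [Module ℂ U] where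
  alg : NLVA U
  act : NLVAModule 𝓗.alg U
  scalar : ∀ (h : H) (u : U), IsTensorLaurent fun n => act.Yw h u n
  vac : ∀ (h : H) (n : ℤ),
      act.Yw h alg.one n = if n = 0 then 𝓗.counit h • alg.one else 0
  compat : ∀ (h : H) (u v : U) (m n : ℤ),
      act.Yw h (alg.Y u v n) m
        = ∑ᶠ (i : ℕ) (p : ℤ), ((-1 : ℂ) ^ i * ((zchoose p i : ℤ) : ℂ)) •
            (TensorProduct.lift
              (((alg.Yc (n - i)).comp ((act.Yw.compr₂ (LinearMap.proj p)).flip u)).compl₂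
                ((act.Yw.compr₂ (LinearMap.proj (m - p + i))).flip v)))
            (𝓗.comul h)

/-- A nonlocal vertex `H`-comodule-algebra. -/
structure NLVComodAlg (𝓗 : NLVBialg H) (V : Type*) [AddCommGroup V] [Module ℂ V] where
  alg : NLVA V
  rho : V →ₗ[ℂ] H ⊗[ℂ] V
  coassoc : ∀ v : V, (LinearMap.lTensor H rho) (rho v)
      = (TensorProduct.assoc ℂ H H V) ((LinearMap.rTensor V 𝓗.comul) (rho v))
  counit_rho : ∀ v : V,
      (TensorProduct.lid ℂ V) ((LinearMap.rTensor V 𝓗.counit) (rho v)) = v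
  rho_one : rho alg.one = 𝓗.alg.one ⊗ₜ alg.one
  rho_mul : ∀ (v v' : V) (n : ℤ),
      rho (alg.Y v v' n)
        = ∑ᶠ p : ℤ, (TensorProduct.map₂ (𝓗.alg.Yc p) (alg.Yc (n - p))) (rho v) (rho v')

/-- The coefficient of `x^n` in
`Y_♯(u⊗v, x)(u'⊗v') = Y(u,x)Y(b¹(v),x)u' ⊗ Y(v²,x)v'`. -/
def Ysharp (𝓗 : NLVBialg H) {U V : Type*} [AddCommGroup U] [Module ℂ U]
    [AddCommGroup V] [Module ℂ V] (MU : NLVModAlg 𝓗 U) (CV : NLVComodAlg 𝓗 V)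
    (u : U) (v : V) (u' : U) (v' : V) (n : ℤ) : U ⊗[ℂ] V :=
  ∑ᶠ (a : ℤ) (p : ℤ),
    (TensorProduct.map
      ((MU.alg.Yc a u).comp ((MU.act.Yw.compr₂ (LinearMap.proj p)).flip u'))
      ((CV.alg.Yc (n - a - p)).flip v'))
    (CV.rho v)

/-- Rearrangement `(H⊗V)⊗U → (H⊗U)⊗V`. -/
def smashSwap {U V : Type*} [AddCommGroup U] [Module ℂ U]
    [AddCommGroup V] [Module ℂ V] :
    (H ⊗[ℂ] V) ⊗[ℂ] U →ₗ[ℂ] (H ⊗[ℂ] U) ⊗[ℂ] V :=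
  ((TensorProduct.assoc ℂ H U V).symm.toLinearMap).comp
    ((LinearMap.lTensor H (TensorProduct.comm ℂ V U).toLinearMap).comp
      (TensorProduct.assoc ℂ H V U).toLinearMap)

/-- The coefficient of `x^n` in `R(x)(v⊗u) = Y(b¹(v),-x)u ⊗ v²`. -/
def Rsmash (𝓗 : NLVBialg H) {U V : Type*} [AddCommGroup U] [Module ℂ U]
    [AddCommGroup V] [Module ℂ V] (MU : NLVModAlg 𝓗 U) (CV : NLVComodAlg 𝓗 V)
    (n : ℤ) : V ⊗[ℂ] U →ₗ[ℂ] U ⊗[ℂ] V :=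
  ((-1 : ℂ) ^ n) •
    ((TensorProduct.map
        (TensorProduct.lift (MU.act.Yw.compr₂ (LinearMap.proj n))) LinearMap.id).comp
      (smashSwap.comp (LinearMap.rTensor U CV.rho)))

end Bialg

set_option linter.unusedSectionVars false

/-! ### Integer binomial coefficients -/

theorem zchoose_eq (n : ℤ) (k : ℕ) : zchoose n k = Ring.choose n k := by
  unfold zchoose
  split_ifs with h
  · lift n to ℕ using h
    rw [Int.toNat_natCast, Ring.choose_natCast]
  · obtain ⟨m, rfl⟩ : ∃ m : ℕ, n = -(m : ℤ) := ⟨(-n).toNat, by omega⟩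
    rw [Ring.choose_neg, Int.negOnePow_def, Units.smul_def, smul_eq_mul]
    have h1 : ((m : ℤ) + k - 1) = ((((k : ℤ) - -(m : ℤ) - 1).toNat : ℕ) : ℤ) := by omega
    rw [h1, Ring.choose_natCast]
    simp

theorem zchoose_zero_right (n : ℤ) : zchoose n 0 = 1 := by
  rw [zchoose_eq, Ring.choose_zero_right]

theorem zchoose_succ_succ (n : ℤ) (k : ℕ) :
    zchoose (n + 1) (k + 1) = zchoose n k + zchoose n (k + 1) := by
  simp only [zchoose_eq, Ring.choose_succ_succ]

theorem zchoose_add (r s : ℤ) (k : ℕ) :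
    zchoose (r + s) k = ∑ ij ∈ Finset.HasAntidiagonal.antidiagonal k, zchoose r ij.1 * zchoose s ij.2 := by
  simp only [zchoose_eq]
  exact Ring.add_choose_eq k (Commute.all _ _)

theorem zchoose_eq_zero {n : ℤ} {k : ℕ} (h0 : 0 ≤ n) (h1 : n < k) : zchoose n k = 0 := by
  rw [zchoose, if_pos h0, Nat.choose_eq_zero_of_lt (by omega), Nat.cast_zero]

/-! ### Double series and multiplication by polynomials -/

section Ops

variable {W : Type*} [AddCommGroup W] [Module ℂ W]

/-- Multiplication of a double series by its first variable. -/
def mulX1 : Module.End ℂ (ℤ → ℤ → W) where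
  toFun F := fun a b => F (a - 1) b
  map_add' _ _ := rfl
  map_smul' _ _ := rfl

/-- Multiplication of a double series by its second variable. -/
def mulX2 : Module.End ℂ (ℤ → ℤ → W) where
  toFun F := fun a b => F a (b - 1)
  map_add' _ _ := rfl
  map_smul' _ _ := rfl

theorem mulX1_apply (F : ℤ → ℤ → W) (a b : ℤ) : mulX1 F a b = F (a - 1) b := rfl

theorem mulX2_apply (F : ℤ → ℤ → W) (a b : ℤ) : mulX2 F a b = F a (b - 1) := rfl

theorem mulX1_pow_apply (k : ℕ) (F : ℤ → ℤ → W) (a b : ℤ) :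
    (mulX1 ^ k) F a b = F (a - k) b := by
  induction k generalizing a with
  | zero => simp
  | succ k ih =>
    rw [pow_succ', Module.End.mul_apply, mulX1_apply, ih]
    congr 1
    push_cast
    ring

theorem mulX2_pow_apply (k : ℕ) (F : ℤ → ℤ → W) (a b : ℤ) :
    (mulX2 ^ k) F a b = F a (b - k) := by
  induction k generalizing b with
  | zero => simp
  | succ k ih =>
    rw [pow_succ', Module.End.mul_apply, mulX2_apply, ih]
    congr 1
    push_cast
    ring

/-- Multiplication of a double series by the sum of its variables. -/
def mulAdd : Module.End ℂ (ℤ → ℤ → W) := mulX1 + mulX2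

/-- Multiplication of a double series by the difference of its variables. -/
def mulSub : Module.End ℂ (ℤ → ℤ → W) := mulX2 - mulX1

theorem mulAdd_apply (F : ℤ → ℤ → W) (a b : ℤ) :
    mulAdd F a b = F (a - 1) b + F a (b - 1) := rfl

theorem mulSub_apply (F : ℤ → ℤ → W) (a b : ℤ) :
    mulSub F a b = F a (b - 1) - F (a - 1) b := rfl

theorem commute_mulX2_mulX1 : Commute (mulX2 : Module.End ℂ (ℤ → ℤ → W)) mulX1 := rfl

theorem neg_mulX1_pow_apply (k : ℕ) (F : ℤ → ℤ → W) (a b : ℤ) :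
    ((-mulX1) ^ k) F a b = (-1 : ℂ) ^ k • F (a - k) b := by
  induction k generalizing a with
  | zero => simp
  | succ k ih =>
    rw [pow_succ', Module.End.mul_apply, LinearMap.neg_apply, Pi.neg_apply, Pi.neg_apply,
      mulX1_apply, ih, pow_succ', neg_one_mul, neg_smul]
    congr 3
    push_cast
    ring

theorem mulAddPow_eq (k : ℕ) (F : ℤ → ℤ → W) :
    mulAddPow k F = (mulAdd ^ k) F := by
  ext a b
  rw [mulAdd, add_comm, commute_mulX2_mulX1.add_pow]
  simp only [mulAddPow, LinearMap.sum_apply, Finset.sum_apply]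
  refine Finset.sum_congr rfl fun j hj => ?_
  have hj' := Finset.mem_range.mp hj
  rw [Module.End.mul_apply, Module.End.natCast_apply, map_nsmul, Pi.smul_apply, Pi.smul_apply,
    Module.End.mul_apply, mulX2_pow_apply, mulX1_pow_apply, Nat.cast_smul_eq_nsmul]
  congr 2
  push_cast [Nat.cast_sub (Nat.lt_succ_iff.mp hj')]
  ring

theorem mulSubPow'_eq (k : ℕ) (F : ℤ → ℤ → W) :
    mulSubPow' k F = (mulSub ^ k) F := by
  ext a b
  have hc : Commute (-mulX1 : Module.End ℂ (ℤ → ℤ → W)) mulX2 :=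
    (commute_mulX2_mulX1 (W := W)).symm.neg_left
  rw [mulSub, sub_eq_neg_add, hc.add_pow]
  simp only [mulSubPow', LinearMap.sum_apply, Finset.sum_apply]
  refine Finset.sum_congr rfl fun j hj => ?_
  have hj' := Finset.mem_range.mp hj
  rw [Module.End.mul_apply, Module.End.natCast_apply, map_nsmul, Pi.smul_apply, Pi.smul_apply,
    Module.End.mul_apply, neg_mulX1_pow_apply, mulX2_pow_apply, ← Nat.cast_smul_eq_nsmul ℂ,
    smul_smul, mul_comm]
  congr 2
  push_cast [Nat.cast_sub (Nat.lt_succ_iff.mp hj')]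
  ring

/-! ### The substitution `x₁ = x₀ + x₂` -/

/-- The exponents of the second variable are bounded below by `M`. -/
def LowerBound2 (M : ℤ) (X : ℤ → ℤ → W) : Prop := ∀ m n, n < M → X m n = 0

theorem LowerBound2.mono {M M' : ℤ} {X : ℤ → ℤ → W} (h : LowerBound2 M X) (hM : M' ≤ M) :
    LowerBound2 M' X := fun m n hn => h m n (hn.trans_le hM)

theorem LowerBound2.mulX1 {M : ℤ} {X : ℤ → ℤ → W} (h : LowerBound2 M X) :
    LowerBound2 M (mulX1 X) := fun m n hn => h (m - 1) n hn

theorem LowerBound2.mulX2 {M : ℤ} {X : ℤ → ℤ → W} (h : LowerBound2 M X) :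
    LowerBound2 M (mulX2 X) := fun m n hn => h m (n - 1) (by omega)

theorem LowerBound2.add {M : ℤ} {X Y : ℤ → ℤ → W} (h : LowerBound2 M X)
    (h' : LowerBound2 M Y) : LowerBound2 M (X + Y) := fun m n hn => by
  simp [h m n hn, h' m n hn]

theorem LowerBound2.sub {M : ℤ} {X Y : ℤ → ℤ → W} (h : LowerBound2 M X)
    (h' : LowerBound2 M Y) : LowerBound2 M (X - Y) := fun m n hn => by
  simp [h m n hn, h' m n hn]

theorem LowerBound2.mulX1_pow {M : ℤ} {X : ℤ → ℤ → W} (h : LowerBound2 M X) (k : ℕ) :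
    LowerBound2 M ((_root_.mulX1 ^ k) X) := fun m n hn => by
  rw [mulX1_pow_apply]; exact h _ _ hn

theorem substAdd02_eq_sum {M : ℤ} {X : ℤ → ℤ → W} (h : LowerBound2 M X) (a b : ℤ) {R : ℕ}
    (hR : b - M < R) :
    substAdd02 X a b =
      ∑ i ∈ Finset.range R, ((zchoose (a + i) i : ℤ) : ℂ) • X (a + i) (b - i) := by
  refine finsum_eq_finsetSum_of_support_subset _ fun i hi => ?_
  rw [Function.mem_support] at hi
  rw [Finset.coe_range, Set.mem_Iio]
  by_contra hc
  exact hi (by rw [h _ _ (by omega), smul_zero])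

theorem substAdd02_support_finite {M : ℤ} {X : ℤ → ℤ → W} (h : LowerBound2 M X) (a b : ℤ) :
    (fun i : ℕ => ((zchoose (a + i) i : ℤ) : ℂ) • X (a + i) (b - i)).HasFiniteSupport := by
  refine (Finset.range (b - M + 1).toNat).finite_toSet.subset fun i hi => ?_
  rw [Function.mem_support] at hi
  rw [Finset.coe_range, Set.mem_Iio]
  by_contra hc
  exact hi (by rw [h _ _ (by omega), smul_zero])

theorem substAdd02_add {M : ℤ} {X Y : ℤ → ℤ → W} (hX : LowerBound2 M X)
    (hY : LowerBound2 M Y) : substAdd02 (X + Y) = substAdd02 X + substAdd02 Y := by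
  ext a b
  simp only [substAdd02, Pi.add_apply, smul_add]
  exact finsum_add_distrib (substAdd02_support_finite hX a b) (substAdd02_support_finite hY a b)

theorem substAdd02_neg (X : ℤ → ℤ → W) : substAdd02 (-X) = -substAdd02 X := by
  ext a b
  simp only [substAdd02, Pi.neg_apply, smul_neg, finsum_neg_distrib]

theorem substAdd02_sub {M : ℤ} {X Y : ℤ → ℤ → W} (hX : LowerBound2 M X)
    (hY : LowerBound2 M Y) : substAdd02 (X - Y) = substAdd02 X - substAdd02 Y := by
  have hY' : LowerBound2 M (-Y) := fun m n hn => by simp [hY m n hn]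
  rw [sub_eq_add_neg, substAdd02_add hX hY', substAdd02_neg, sub_eq_add_neg]

theorem substAdd02_sum {ι : Type*} (s : Finset ι) {M : ℤ} {X : ι → ℤ → ℤ → W}
    (hX : ∀ i ∈ s, LowerBound2 M (X i)) :
    substAdd02 (∑ i ∈ s, X i) = ∑ i ∈ s, substAdd02 (X i) := by
  ext a b
  simp only [substAdd02, Finset.sum_apply, Finset.smul_sum]
  exact finsum_sum_comm s _ fun i hi => substAdd02_support_finite (hX i hi) a b

theorem substAdd02_zero : substAdd02 (0 : ℤ → ℤ → W) = 0 := by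
  ext a b
  simp [substAdd02]

theorem map_substAdd02 {W' : Type*} [AddCommGroup W'] [Module ℂ W'] (f : W →ₗ[ℂ] W')
    {M : ℤ} {X : ℤ → ℤ → W} (hX : LowerBound2 M X) (a b : ℤ) :
    f (substAdd02 X a b) = substAdd02 (fun m n => f (X m n)) a b := by
  unfold substAdd02
  rw [map_finsum f (substAdd02_support_finite hX a b)]
  simp only [map_smul]

theorem substAdd02_mulX2 (X : ℤ → ℤ → W) : substAdd02 (mulX2 X) = mulX2 (substAdd02 X) := by
  ext a b
  simp only [substAdd02, mulX2_apply]
  refine finsum_congr fun i => ?_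
  rw [sub_right_comm]

theorem substAdd02_mulX1 {M : ℤ} {X : ℤ → ℤ → W} (hX : LowerBound2 M X) :
    substAdd02 (mulX1 X) = mulAdd (substAdd02 X) := by
  ext a b
  obtain ⟨R, hR⟩ : ∃ R : ℕ, b - M < R := ⟨(b - M + 1).toNat, by omega⟩
  simp only [mulAdd_apply]
  rw [substAdd02_eq_sum (R := R + 1) hX.mulX1 a b (by omega),
    substAdd02_eq_sum (R := R + 1) hX (a - 1) b (by omega),
    substAdd02_eq_sum (R := R) hX a (b - 1) (by omega), Finset.sum_range_succ',
    Finset.sum_range_succ' _ R, add_right_comm, ← Finset.sum_add_distrib]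
  simp only [mulX1_apply, Nat.cast_zero, zchoose_zero_right, add_zero]
  congr 1
  refine Finset.sum_congr rfl fun i _ => ?_
  have h1 : a + ((i + 1 : ℕ) : ℤ) = (a + i) + 1 := by push_cast; ring
  have h2 : a - 1 + ((i + 1 : ℕ) : ℤ) = a + i := by push_cast; ring
  have h3 : b - ((i + 1 : ℕ) : ℤ) = b - 1 - i := by push_cast; ring
  have h4 : a + (i : ℤ) + 1 - 1 = a + i := by ring
  rw [h1, h2, h3, h4, zchoose_succ_succ, Int.cast_add, add_smul, add_comm]

theorem substAdd02_mulX1_pow {M : ℤ} {X : ℤ → ℤ → W} (hX : LowerBound2 M X) (k : ℕ) :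
    substAdd02 ((mulX1 ^ k) X) = (mulAdd ^ k) (substAdd02 X) := by
  induction k with
  | zero => simp
  | succ k ih =>
    rw [pow_succ', Module.End.mul_apply, substAdd02_mulX1 (hX.mulX1_pow k), ih, pow_succ',
      Module.End.mul_apply]

theorem LowerBound2.mulSub_pow {M : ℤ} {X : ℤ → ℤ → W} (hX : LowerBound2 M X) (k : ℕ) :
    LowerBound2 M ((mulSub ^ k) X) := by
  induction k with
  | zero => simpa using hX
  | succ k ih =>
    rw [pow_succ', Module.End.mul_apply, mulSub, LinearMap.sub_apply]
    exact ih.mulX2.sub ih.mulX1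

theorem substAdd02_mulSub_pow {M : ℤ} {X : ℤ → ℤ → W} (hX : LowerBound2 M X) (k : ℕ) :
    substAdd02 ((mulSub ^ k) X) = ((-mulX1) ^ k) (substAdd02 X) := by
  induction k with
  | zero => simp
  | succ k ih =>
    have hk := hX.mulSub_pow k
    rw [pow_succ', Module.End.mul_apply, mulSub, LinearMap.sub_apply, ← mulSub,
      substAdd02_sub hk.mulX2 hk.mulX1, substAdd02_mulX2, substAdd02_mulX1 hk, ih,
      pow_succ', Module.End.mul_apply, mulAdd, LinearMap.add_apply, LinearMap.neg_apply]
    abel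

end Ops

section Assoc

variable {W : Type*} [AddCommGroup W] [Module ℂ W]

theorem map_mulAdd_pow {W' : Type*} [AddCommGroup W'] [Module ℂ W'] (f : W →ₗ[ℂ] W') (k : ℕ)
    (X : ℤ → ℤ → W) (a b : ℤ) :
    f ((mulAdd ^ k) X a b) = (mulAdd ^ k) (fun m n => f (X m n)) a b := by
  induction k generalizing a b with
  | zero => simp
  | succ k ih => simp only [pow_succ', Module.End.mul_apply, mulAdd_apply, map_add, ih]

theorem mulAdd_pow_vanish {N : ℤ} {X : ℤ → ℤ → W} (h : ∀ a b, a < N → X a b = 0) (k : ℕ) :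
    ∀ a b, a < N → (mulAdd ^ k) X a b = 0 := by
  induction k with
  | zero => simpa using h
  | succ k ih =>
    intro a b hab
    rw [pow_succ', Module.End.mul_apply, mulAdd_apply, ih _ _ hab, ih _ _ (by omega), add_zero]

theorem eq_zero_of_mulAdd_eq_zero {N : ℤ} {X : ℤ → ℤ → W} (h : ∀ a b, a < N → X a b = 0)
    (h0 : mulAdd X = 0) : X = 0 := by
  have key : ∀ d : ℕ, ∀ a b, a < N + d → X a b = 0 := by
    intro d
    induction d with
    | zero => simpa using h
    | succ d ih =>
      intro a b hab
      have h1 := congrFun (congrFun h0 a) (b + 1)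
      rw [mulAdd_apply, ih (a - 1) _ (by push_cast at hab; omega), zero_add,
        add_sub_cancel_right] at h1
      exact h1
  ext a b
  exact key (a - N + 1).toNat a b (by omega)

theorem eq_zero_of_mulAdd_pow_eq_zero {N : ℤ} {X : ℤ → ℤ → W} (h : ∀ a b, a < N → X a b = 0)
    (k : ℕ) (h0 : (mulAdd ^ k) X = 0) : X = 0 := by
  induction k with
  | zero => simpa using h0
  | succ k ih =>
    rw [pow_succ', Module.End.mul_apply] at h0
    exact ih (eq_zero_of_mulAdd_eq_zero (mulAdd_pow_vanish h k) h0)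

/-- Weak associativity of order `k` for a product `X` and an iterate `Z`. -/
def WeakAssoc (k : ℕ) (X Z : ℤ → ℤ → W) : Prop :=
  (mulAdd ^ k) (substAdd02 X) = (mulAdd ^ k) Z

theorem weakAssoc_iff (k : ℕ) (X Z : ℤ → ℤ → W) :
    WeakAssoc k X Z ↔ ∀ a b, mulAddPow k (substAdd02 X) a b = mulAddPow k Z a b := by
  simp only [WeakAssoc, mulAddPow_eq, funext_iff]

theorem WeakAssoc.mono {k k' : ℕ} (hk : k ≤ k') {X Z : ℤ → ℤ → W} (h : WeakAssoc k X Z) :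
    WeakAssoc k' X Z := by
  obtain ⟨j, rfl⟩ := Nat.exists_eq_add_of_le' hk
  rw [WeakAssoc] at h ⊢
  rw [pow_add, Module.End.mul_apply, Module.End.mul_apply, h]

/-- The product `X` has second exponents bounded below by `M`, and its substitution becomes
bounded below by `N` in the first exponent after multiplication by `(x₀ + x₂)^l`. -/
structure Good (l : ℕ) (N M : ℤ) (X : ℤ → ℤ → W) : Prop where
  lower : LowerBound2 M X
  vanish : ∀ a b, a < N → (mulAdd ^ l) (substAdd02 X) a b = 0

theorem Good.mono {l l' : ℕ} {N N' M M' : ℤ} {X : ℤ → ℤ → W} (h : Good l N M X)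
    (hl : l ≤ l') (hN : N' ≤ N) (hM : M' ≤ M) : Good l' N' M' X := by
  refine ⟨h.lower.mono hM, fun a b hab => ?_⟩
  obtain ⟨j, rfl⟩ := Nat.exists_eq_add_of_le' hl
  rw [pow_add, Module.End.mul_apply]
  exact mulAdd_pow_vanish h.vanish j a b (hab.trans_le hN)

theorem Good.zero (l : ℕ) (N M : ℤ) : Good l N M (0 : ℤ → ℤ → W) :=
  ⟨fun _ _ _ => rfl, fun a b _ => by rw [substAdd02_zero, map_zero]; rfl⟩

theorem Good.map {W' : Type*} [AddCommGroup W'] [Module ℂ W'] (f : W →ₗ[ℂ] W') {l : ℕ}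
    {N M : ℤ} {X : ℤ → ℤ → W} (h : Good l N M X) : Good l N M fun m n => f (X m n) := by
  refine ⟨fun m n hn => by simp [h.lower m n hn], fun a b hab => ?_⟩
  have : substAdd02 (fun m n => f (X m n)) = fun a b => f (substAdd02 X a b) := by
    ext a b; rw [map_substAdd02 f h.lower]
  rw [this, ← map_mulAdd_pow, h.vanish a b hab, map_zero]

theorem Good.smul (c : ℂ) {l : ℕ} {N M : ℤ} {X : ℤ → ℤ → W} (h : Good l N M X) :
    Good l N M (c • X) := h.map (c • LinearMap.id)

theorem Good.sum {ι : Type*} (s : Finset ι) {l : ℕ} {N M : ℤ} {X : ι → ℤ → ℤ → W}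
    (h : ∀ i ∈ s, Good l N M (X i)) : Good l N M (∑ i ∈ s, X i) := by
  refine ⟨fun m n hn => ?_, fun a b hab => ?_⟩
  · rw [Finset.sum_apply, Finset.sum_apply]
    exact Finset.sum_eq_zero fun i hi => (h i hi).lower m n hn
  · rw [substAdd02_sum s fun i hi => (h i hi).lower, map_sum, Finset.sum_apply, Finset.sum_apply]
    exact Finset.sum_eq_zero fun i hi => (h i hi).vanish a b hab

theorem Good.mulX1 {l : ℕ} {N M : ℤ} {X : ℤ → ℤ → W} (h : Good l N M X) (k : ℕ) :
    Good l N M ((_root_.mulX1 ^ k) X) := by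
  refine ⟨h.lower.mulX1_pow k, fun a b hab => ?_⟩
  rw [substAdd02_mulX1_pow h.lower, ← Module.End.mul_apply, ← pow_add, add_comm, pow_add,
    Module.End.mul_apply]
  exact mulAdd_pow_vanish h.vanish k a b hab

theorem substAdd02_mulX2_pow (X : ℤ → ℤ → W) (k : ℕ) :
    substAdd02 ((mulX2 ^ k) X) = (mulX2 ^ k) (substAdd02 X) := by
  induction k with
  | zero => simp
  | succ k ih => rw [pow_succ', Module.End.mul_apply, substAdd02_mulX2, ih]; rfl

theorem commute_mulAdd_mulX2 : Commute (mulAdd : Module.End ℂ (ℤ → ℤ → W)) mulX2 := rfl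

theorem commute_mulAdd_mulX1 : Commute (mulAdd : Module.End ℂ (ℤ → ℤ → W)) mulX1 := rfl

theorem Good.mulX2 {l : ℕ} {N M : ℤ} {X : ℤ → ℤ → W} (h : Good l N M X) (k : ℕ) :
    Good l N M ((_root_.mulX2 ^ k) X) := by
  refine ⟨fun m n hn => ?_, fun a b hab => ?_⟩
  · rw [mulX2_pow_apply]; exact h.lower _ _ (by omega)
  · rw [substAdd02_mulX2_pow, ← Module.End.mul_apply, (commute_mulAdd_mulX2.pow_pow l k).eq,
      Module.End.mul_apply, mulX2_pow_apply]
    exact h.vanish _ _ hab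

theorem good_iff {l : ℕ} {N M : ℤ} {X : ℤ → ℤ → W} (h : LowerBound2 M X) :
    Good l N M X ↔ ∀ a b, a < N → substAdd02 ((_root_.mulX1 ^ l) X) a b = 0 := by
  rw [substAdd02_mulX1_pow h]
  exact ⟨fun h => h.vanish, fun h' => ⟨h, h'⟩⟩

theorem Good.finsum {κ : Type*} {l : ℕ} {N M : ℤ} {Y : κ → ℤ → ℤ → W}
    (hfin : ∀ m n, (fun x => Y x m n).HasFiniteSupport) (h : ∀ x, Good l N M (Y x)) :
    Good l N M fun m n => ∑ᶠ x, Y x m n := by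
  have hlow : LowerBound2 M fun m n => ∑ᶠ x, Y x m n := fun m n hn => by
    simp [fun x => (h x).lower m n hn]
  rw [good_iff hlow]
  intro a b hab
  obtain ⟨R, hR⟩ : ∃ R : ℕ, b - M < R := ⟨(b - M + 1).toNat, by omega⟩
  rw [substAdd02_eq_sum (hlow.mulX1_pow l) a b hR]
  simp only [mulX1_pow_apply, smul_finsum]
  rw [← finsum_sum_comm]
  · refine finsum_eq_zero_of_forall_eq_zero fun x => ?_
    have := (good_iff (h x).lower).1 (h x) a b hab
    rw [substAdd02_eq_sum ((h x).lower.mulX1_pow l) a b hR] at this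
    simpa only [mulX1_pow_apply] using this
  · intro i _
    exact (hfin _ _).subset (Function.support_const_smul_subset _ _)

theorem Good.eq_zero {l : ℕ} {N M : ℤ} {X : ℤ → ℤ → W} (h : Good l N M X) {p q : ℤ}
    (hpq : p + q < N + M - l) : X p q = 0 := by
  have key : ∀ d : ℕ, ∀ a b : ℤ, b < M + d → a + b < N + M → (_root_.mulX1 ^ l) X a b = 0 := by
    intro d
    induction d with
    | zero => intro a b hb _; exact h.lower.mulX1_pow l _ _ (by simpa using hb)
    | succ d ih =>
      intro a b hb hab
      by_cases hbM : b < M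
      · exact h.lower.mulX1_pow l _ _ hbM
      have h0 := (good_iff h.lower).1 h a b (by omega)
      obtain ⟨R, hR⟩ : ∃ R : ℕ, b - M < R := ⟨(b - M + 1).toNat, by omega⟩
      rw [substAdd02_eq_sum (R := R + 1) (h.lower.mulX1_pow l) a b (by push_cast; omega),
        Finset.sum_range_succ', Finset.sum_eq_zero, zero_add] at h0
      · simpa [zchoose_zero_right] using h0
      · intro i _
        rw [ih _ _ (by push_cast at hb ⊢; omega) (by push_cast; omega), smul_zero]
  have := key (q - M + 1).toNat (p + l) q (by omega) (by omega)
  rwa [mulX1_pow_apply, add_sub_cancel_right] at this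

theorem WeakAssoc.good {l : ℕ} {N M : ℤ} {X Z : ℤ → ℤ → W} (h : WeakAssoc l X Z)
    (hX : LowerBound2 M X) (hZ : ∀ a b, a < N → Z a b = 0) : Good l N M X :=
  ⟨hX, fun a b hab => by rw [h]; exact mulAdd_pow_vanish hZ l a b hab⟩

theorem WeakAssoc.descend {l l' : ℕ} {N M : ℤ} {X Z : ℤ → ℤ → W} (h : WeakAssoc l' X Z)
    (hX : Good l N M X) (hZ : ∀ a b, a < N → Z a b = 0) : WeakAssoc l X Z := by
  have h0 : (mulAdd ^ l) (substAdd02 X - Z) = 0 := by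
    refine eq_zero_of_mulAdd_pow_eq_zero (N := N) (fun a b hab => ?_) l' ?_
    · rw [map_sub, Pi.sub_apply, Pi.sub_apply, hX.vanish a b hab,
        mulAdd_pow_vanish hZ l a b hab, sub_zero]
    · rw [← Module.End.mul_apply, ← pow_add, add_comm, pow_add, Module.End.mul_apply,
        map_sub (mulAdd ^ l'), h, sub_self, map_zero]
  rwa [map_sub, sub_eq_zero] at h0

theorem WeakAssoc.add {k : ℕ} {M M' : ℤ} {X X' Z Z' : ℤ → ℤ → W} (hX : LowerBound2 M X)
    (hX' : LowerBound2 M' X') (h : WeakAssoc k X Z) (h' : WeakAssoc k X' Z') :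
    WeakAssoc k (X + X') (Z + Z') := by
  rw [WeakAssoc, substAdd02_add (hX.mono (min_le_left M M')) (hX'.mono (min_le_right M M')),
    map_add, map_add, h, h']

theorem exists_good_uniform {ι κ : Type*} (T : Finset ι) {X : ι → κ → ℤ → ℤ → W}
    (h : ∀ s ∈ T, ∃ l N M, ∀ x, Good l N M (X s x)) :
    ∃ l N M, ∀ s ∈ T, ∀ x, Good l N M (X s x) := by
  classical
  induction T using Finset.induction_on with
  | empty => exact ⟨0, 0, 0, by simp⟩
  | insert s T _ ih =>
    obtain ⟨l, N, M, h1⟩ := ih fun t ht => h t (Finset.mem_insert_of_mem ht)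
    obtain ⟨l', N', M', h2⟩ := h s (Finset.mem_insert_self _ _)
    refine ⟨max l l', min N N', min M M', fun t ht x => ?_⟩
    rcases Finset.mem_insert.1 ht with rfl | ht
    · exact (h2 x).mono (le_max_right _ _) (min_le_right _ _) (min_le_right _ _)
    · exact (h1 t ht x).mono (le_max_left _ _) (min_le_left _ _) (min_le_left _ _)

end Assoc

/-! ### Finite sums over families with finite support -/

theorem finsum_swap {α β M : Type*} [AddCommMonoid M] (f : α → β → M)
    (hf : (fun x : α × β => f x.1 x.2).HasFiniteSupport) :
    ∑ᶠ (a : α) (b : β), f a b = ∑ᶠ (b : β) (a : α), f a b := by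
  have h1 := finsum_curry _ hf
  have hf' : (fun x : β × α => f x.2 x.1).HasFiniteSupport :=
    Set.Finite.preimage (Prod.swap_injective.injOn) hf
  have h2 := finsum_curry _ hf'
  rw [← h1, ← h2]
  exact (finsum_comp_equiv (Equiv.prodComm β α) (f := fun x : α × β => f x.1 x.2)).symm

theorem finsum_comp_of_injective {α β M : Type*} [AddCommMonoid M] {e : α → β} {f : β → M}
    (he : Function.Injective e) (hf : ∀ y, y ∉ Set.range e → f y = 0) :
    ∑ᶠ x, f (e x) = ∑ᶠ y, f y := by
  classical
  rw [← finsum_mem_range he]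
  refine finsum_congr fun y => ?_
  by_cases hy : y ∈ Set.range e
  · exact finsum_eq_if.trans (if_pos hy)
  · exact (finsum_eq_if.trans (if_neg hy)).trans (hf y hy).symm

theorem finite_of_fiber_bounds {S : Set (ℤ × ℤ)} (a b : ℤ) (c d : ℤ → ℤ)
    (h : ∀ x ∈ S, a ≤ x.1 ∧ x.1 ≤ b ∧ c x.1 ≤ x.2 ∧ x.2 ≤ d x.1) : S.Finite := by
  refine ((Finset.Icc a b).sigma fun i => Finset.Icc (c i) (d i)).finite_toSet.image
    (fun y : (_ : ℤ) × ℤ => (y.1, y.2)) |>.subset fun x hx => ?_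
  obtain ⟨h1, h2, h3, h4⟩ := h x hx
  exact ⟨⟨x.1, x.2⟩, by simp [h1, h2, h3, h4], rfl⟩

/-! ### Expansion of `f(x₂ - x₁)` -/

/-- The coefficients of `f(x₂ - x₁)`, expanded in nonnegative powers of `x₁`. -/
def expandSub (f : ℤ → ℂ) : ℤ → ℤ → ℂ := fun i j =>
  if 0 ≤ i then (-1) ^ i.toNat * (zchoose (i + j) i.toNat : ℂ) * f (i + j) else 0

theorem expandSub_natCast (f : ℤ → ℂ) (i : ℕ) (j : ℤ) :
    expandSub f i j = (-1) ^ i * (zchoose (i + j) i : ℂ) * f (i + j) := by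
  simp [expandSub]

theorem expandSub_of_neg (f : ℤ → ℂ) {i : ℤ} (hi : i < 0) (j : ℤ) : expandSub f i j = 0 :=
  if_neg (by omega)

theorem expandSub_of_add_lt {f : ℤ → ℂ} {N : ℤ} (hf : ∀ p, p < N → f p = 0) {i j : ℤ}
    (h : i + j < N) : expandSub f i j = 0 := by
  unfold expandSub
  split_ifs <;> simp [hf _ h]

theorem expandSub_shift (f : ℤ → ℂ) :
    expandSub (fun p => f (p - 1)) = mulSub (expandSub f) := by
  ext i j
  rw [mulSub_apply]
  rcases lt_or_ge i 0 with hi | hi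
  · rw [expandSub_of_neg _ hi, expandSub_of_neg _ hi, expandSub_of_neg _ (by omega), sub_zero]
  lift i to ℕ using hi
  have e1 : (i : ℤ) + (j - 1) = i + j - 1 := by ring
  rcases i with _ | i
  · rw [expandSub_of_neg _ (i := ((0 : ℕ) : ℤ) - 1) (by omega), expandSub_natCast,
      expandSub_natCast, e1]
    simp [zchoose_zero_right]
  · have e2 : ((i + 1 : ℕ) : ℤ) - 1 = (i : ℕ) := by push_cast; ring
    have e3 : ((i + 1 : ℕ) : ℤ) + j - 1 = i + j := by push_cast; ring
    have e4 : ((i + 1 : ℕ) : ℤ) + j = i + j + 1 := by push_cast; ring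
    rw [e2, expandSub_natCast, expandSub_natCast, expandSub_natCast, e1, e3, e4,
      zchoose_succ_succ]
    push_cast
    ring

theorem expandSub_shift_pow (k : ℕ) (f : ℤ → ℂ) :
    expandSub (fun p => f (p - k)) = (mulSub ^ k) (expandSub f) := by
  induction k with
  | zero => simp
  | succ k ih =>
    rw [pow_succ', Module.End.mul_apply, ← ih, ← expandSub_shift]
    congr 1
    ext p
    congr 1
    push_cast
    ring

/-- The constant double series `1`. -/
def delta2 : ℤ → ℤ → ℂ := fun a b => if a = 0 ∧ b = 0 then 1 else 0

theorem expandSub_delta (k : ℕ) :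
    expandSub (fun p => if p = k then 1 else 0) = (mulSub ^ k) delta2 := by
  have h0 : expandSub (fun p => if p = 0 then 1 else 0) = delta2 := by
    ext i j
    rcases lt_or_ge i 0 with hi | hi
    · rw [expandSub_of_neg _ hi, delta2, if_neg (by omega)]
    lift i to ℕ using hi
    rw [expandSub_natCast, delta2]
    rcases Nat.eq_zero_or_pos i with rfl | hi
    · simp [zchoose_zero_right]
    · rw [if_neg (c := (i : ℤ) = 0 ∧ j = 0) (by omega)]
      split_ifs with h
      · rw [h, zchoose_eq_zero le_rfl (by omega)]; simp
      · simp
  rw [← h0, ← expandSub_shift_pow]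
  congr 1
  ext p
  simp [sub_eq_zero]

theorem expandSub_lowerBound {g : ℤ → ℂ} (hg : ∀ p, p < 0 → g p = 0) :
    LowerBound2 0 (expandSub g) := by
  intro i j hj
  rcases lt_or_ge i 0 with hi | hi
  · exact expandSub_of_neg _ hi j
  rcases lt_or_ge (i + j) 0 with h | h
  · exact expandSub_of_add_lt hg h
  lift i to ℕ using hi
  rw [expandSub_natCast, zchoose_eq_zero h (by omega)]
  simp

theorem substAdd02_expandSub {g : ℤ → ℂ} (hg : ∀ p, p < 0 → g p = 0) (a b : ℤ) :
    substAdd02 (expandSub g) a b = if b = 0 then (-1) ^ a * g a else 0 := by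
  have hdl : LowerBound2 0 delta2 := fun m n hn => if_neg (by omega)
  have hd : substAdd02 delta2 = delta2 := by
    ext a b
    rw [substAdd02_eq_sum (R := b.toNat + 1) hdl a b (by omega), Finset.sum_range_succ',
      Finset.sum_eq_zero]
    · simp [zchoose_zero_right]
    · intro i _
      unfold delta2
      split_ifs with h
      · rw [h.1, zchoose_eq_zero le_rfl (by omega)]; simp
      · simp
  have key : substAdd02 (expandSub g) a b
      = g (a + b) • substAdd02 (expandSub fun p => if p = a + b then 1 else 0) a b := by
    unfold substAdd02
    rw [smul_finsum]
    refine finsum_congr fun i => ?_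
    rw [smul_comm]
    congr 1
    have e : a + (i : ℤ) + (b - i) = a + b := by ring
    unfold expandSub
    rw [e]
    split_ifs <;> simp [mul_comm]
  rw [key]
  rcases lt_or_ge (a + b) 0 with h | h
  · rw [hg _ h, zero_smul]
    split_ifs with hb
    · rw [hg a (by omega), mul_zero]
    · rfl
  · obtain ⟨p, hp⟩ := Int.eq_ofNat_of_zero_le h
    rw [hp, expandSub_delta, substAdd02_mulSub_pow hdl, hd, neg_mulX1_pow_apply, delta2]
    split_ifs with h1 h2 h2
    · obtain rfl : a = p := by omega
      simp [mul_comm]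
    · omega
    · omega
    · simp

/-! ### Series in `V ⊗ ℂ((x))` and the twisted products -/

theorem IsTensorLaurent.exists_decomp {A B : Type*} [AddCommGroup A] [Module ℂ A]
    [AddCommGroup B] [Module ℂ B] {q : ℤ → A ⊗[ℂ] B} (hq : IsTensorLaurent q) :
    ∃ (T : Finset (A × B)) (f : A × B → ℤ → ℂ) (N : ℤ), (∀ s p, p < N → f s p = 0) ∧
      ∀ p, q p = ∑ s ∈ T, f s p • (s.1 ⊗ₜ[ℂ] s.2) := by
  classical
  obtain ⟨⟨N, hN⟩, F, ⟨G, rfl⟩, hF⟩ := hq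
  choose S hS using fun x : A ⊗[ℂ] B => TensorProduct.exists_finset (R := ℂ) x
  set T := G.biUnion S
  have hT : ∀ p, ∃ c : A × B → ℂ, q p = ∑ s ∈ T, c s • (s.1 ⊗ₜ[ℂ] s.2) := by
    intro p
    have hp : q p ∈ Submodule.span ℂ ((fun s : A × B => s.1 ⊗ₜ[ℂ] s.2) '' (T : Set (A × B))) := by
      refine Submodule.span_le.2 (fun x hx => ?_) (hF p)
      rw [SetLike.mem_coe, hS x]
      refine Submodule.sum_mem _ fun s hs => Submodule.subset_span ⟨s, ?_, rfl⟩
      exact Finset.mem_coe.2 (Finset.mem_biUnion.2 ⟨x, hx, hs⟩)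
    obtain ⟨c, hc⟩ := (Submodule.mem_span_image_finset_iff_exists_fun ℂ).1 hp
    refine ⟨fun s => if h : s ∈ T then c ⟨s, h⟩ else 0, ?_⟩
    rw [← hc, ← Finset.sum_coe_sort T]
    exact Finset.sum_congr rfl fun s _ => by simp
  choose c hc using hT
  refine ⟨T, fun s p => if p < N then 0 else c p s, N, fun s p hp => if_pos hp, fun p => ?_⟩
  by_cases hp : p < N
  · simp [hp, hN]
  · simp only [hp, if_false]; exact hc p

section Twisted

variable {A B W : Type*} [AddCommGroup A] [Module ℂ A] [AddCommGroup B] [Module ℂ B]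
  [AddCommGroup W] [Module ℂ W]

theorem sandwichMod_tmul (YA : A →ₗ[ℂ] W →ₗ[ℂ] (ℤ → W)) (YB : B →ₗ[ℂ] W →ₗ[ℂ] (ℤ → W))
    (w : W) (e j : ℤ) (a : A) (b : B) :
    sandwichMod YA YB w e j (a ⊗ₜ b) = YA a (YB b w j) e := rfl

theorem expandSub_support_finite {YA : A →ₗ[ℂ] W →ₗ[ℂ] (ℤ → W)}
    {YB : B →ₗ[ℂ] W →ₗ[ℂ] (ℤ → W)} (hA : ∀ a w, IsLaurent (YA a w))
    (hB : ∀ b w, IsLaurent (YB b w)) {f : ℤ → ℂ} {N : ℤ} (hf : ∀ p, p < N → f p = 0)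
    (a : A) (b : B) (w : W) (m n : ℤ) :
    (fun x : ℤ × ℤ => expandSub f x.1 x.2 •
      YA a (YB b w (m - x.1)) (n - x.2)).HasFiniteSupport := by
  obtain ⟨c, hc⟩ := hB b w
  choose d hd using fun i : ℤ => hA a (YB b w (m - i))
  refine finite_of_fiber_bounds 0 (m - c) (fun i => N - i) (fun i => n - d i) fun x hx => ?_
  rw [Function.mem_support] at hx
  refine ⟨?_, ?_, ?_, ?_⟩ <;> by_contra h <;> apply hx
  · rw [expandSub_of_neg _ (by omega), zero_smul]
  · rw [hc _ (by omega), map_zero, Pi.zero_apply, smul_zero]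
  · rw [expandSub_of_add_lt hf (by omega), zero_smul]
  · rw [hd _ _ (by omega), smul_zero]

theorem twistRHS_eq {YA : A →ₗ[ℂ] W →ₗ[ℂ] (ℤ → W)}
    {YB : B →ₗ[ℂ] W →ₗ[ℂ] (ℤ → W)} (hA : ∀ a w, IsLaurent (YA a w))
    (hB : ∀ b w, IsLaurent (YB b w)) {q : ℤ → A ⊗[ℂ] B} {T : Finset (A × B)}
    {f : A × B → ℤ → ℂ} {N : ℤ} (hf : ∀ s p, p < N → f s p = 0)
    (hq : ∀ p, q p = ∑ s ∈ T, f s p • (s.1 ⊗ₜ[ℂ] s.2)) (w : W) (m n : ℤ) :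
    twistRHS YA YB q w m n = ∑ s ∈ T, ∑ᶠ x : ℤ × ℤ,
      expandSub (f s) x.1 x.2 • YA s.1 (YB s.2 w (m - x.1)) (n - x.2) := by
  set h : A × B → ℤ × ℤ → W := fun s x =>
    expandSub (f s) x.1 x.2 • YA s.1 (YB s.2 w (m - x.1)) (n - x.2) with hh
  have hfin : ∀ s, (h s).HasFiniteSupport := fun s =>
    expandSub_support_finite hA hB (hf s) s.1 s.2 w m n
  set e : ℕ × ℤ → ℤ × ℤ := fun y => (y.1, y.2 - y.1) with he
  have hinj : Function.Injective e := by
    rintro ⟨i, p⟩ ⟨j, r⟩ hxy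
    simp only [he, Prod.mk.injEq] at hxy
    ext <;> simp <;> omega
  have hfin' : ∀ s, (fun y => h s (e y)).HasFiniteSupport := fun s =>
    Set.Finite.preimage hinj.injOn (hfin s)
  have hsum : ∀ s, ∑ᶠ x, h s x = ∑ᶠ y, h s (e y) := fun s =>
    (finsum_comp_of_injective hinj fun x hx => by
      have : x.1 < 0 := by
        by_contra hc
        exact hx ⟨(x.1.toNat, x.2 + x.1), by ext <;> simp [he] <;> omega⟩
      simp only [hh]
      rw [expandSub_of_neg _ this, zero_smul]).symm
  rw [Finset.sum_congr rfl fun s _ => hsum s, ← finsum_sum_comm T (fun y s => h s (e y))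
    fun s _ => hfin' s, finsum_curry]
  · unfold twistRHS
    refine finsum_congr fun i => finsum_congr fun p => ?_
    rw [hq, map_sum, Finset.smul_sum]
    refine Finset.sum_congr rfl fun s _ => ?_
    simp only [hh, he]
    rw [map_smul, sandwichMod_tmul, smul_smul, expandSub_natCast, add_sub_cancel,
      ← sub_add]
  · refine (T.finite_toSet.biUnion fun s _ => hfin' s).subset fun y hy => ?_
    rw [Function.mem_support] at hy
    obtain ⟨s, hs, h0⟩ := Finset.exists_ne_zero_of_sum_ne_zero hy
    exact Set.mem_biUnion hs h0

end Twisted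

/-! ### Uniform pole bounds for products of two operators -/

section Uniform

variable {U V W : Type*} [AddCommGroup U] [Module ℂ U] [AddCommGroup V] [Module ℂ V]
  [AddCommGroup W] [Module ℂ W]

/-- The coefficient of `x^n` in `Y(a,x)` as an endomorphism. -/
def modeOp (Y : U →ₗ[ℂ] W →ₗ[ℂ] (ℤ → W)) (a : U) (n : ℤ) : W →ₗ[ℂ] W :=
  (LinearMap.proj n).comp (Y a)

theorem modeOp_apply (Y : U →ₗ[ℂ] W →ₗ[ℂ] (ℤ → W)) (a : U) (n : ℤ) (w : W) :
    modeOp Y a n w = Y a w n := rfl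

/-- The product `Y(a,x₁)Y'(b,x₂)w`. -/
def prod2 (Y : U →ₗ[ℂ] W →ₗ[ℂ] (ℤ → W)) (Y' : V →ₗ[ℂ] W →ₗ[ℂ] (ℤ → W)) (a : U) (b : V)
    (w : W) : ℤ → ℤ → W := fun m n => Y a (Y' b w n) m

/-- Pole bounds for all products of two operators, uniform on a set of vectors. -/
def UniformGood (Y : U →ₗ[ℂ] W →ₗ[ℂ] (ℤ → W)) (Ω : Set W) : Prop :=
  ∀ u u', ∃ l N M, ∀ w ∈ Ω, Good l N M (prod2 Y Y u u' w)

theorem Good.expandSub {T : Finset (V × U)} {f : V × U → ℤ → ℂ}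
    {Y : V × U → ℤ × ℤ → ℤ → ℤ → W} {l : ℕ} {N M : ℤ}
    (hfin : ∀ s m n, (fun x : ℤ × ℤ => _root_.expandSub (f s) x.1 x.2 • Y s x m n).HasFiniteSupport)
    (h : ∀ s ∈ T, ∀ x : ℤ × ℤ, 0 ≤ x.1 → Good l N M (Y s x)) :
    Good l N M fun m n => ∑ s ∈ T, ∑ᶠ x : ℤ × ℤ,
      _root_.expandSub (f s) x.1 x.2 • Y s x m n := by
  have key : ∀ s ∈ T, Good l N M fun m n => ∑ᶠ x : ℤ × ℤ,
      _root_.expandSub (f s) x.1 x.2 • Y s x m n := fun s hs => by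
    refine Good.finsum (Y := fun (x : ℤ × ℤ) m n => _root_.expandSub (f s) x.1 x.2 • Y s x m n)
      (hfin s) fun x => ?_
    rcases lt_or_ge x.1 0 with hx | hx
    · simp only [expandSub_of_neg _ hx, zero_smul]
      exact Good.zero l N M
    · exact (h s hs x hx).smul _
  convert Good.sum T key using 1
  ext m n
  simp only [Finset.sum_apply]

theorem UniformGood.singleton {𝒰 : NLVA U} (MU : NLVAModule 𝒰 W) (w : W) :
    UniformGood MU.Yw {w} := by
  intro u u'
  obtain ⟨k, hk⟩ := MU.weak_assoc u u' w
  obtain ⟨N, hN⟩ := 𝒰.trunc u u'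
  obtain ⟨M, hM⟩ := MU.trunc u' w
  refine ⟨k, N, M, fun w' hw' => ?_⟩
  rw [Set.mem_singleton_iff.1 hw']
  refine WeakAssoc.good (Z := fun a b => MU.Yw (𝒰.Y u u' a) w b) ((weakAssoc_iff _ _ _).2 hk)
    (fun m n hn => ?_) fun a b hab => ?_
  · rw [prod2, hM n hn, map_zero, Pi.zero_apply]
  · rw [hN a hab, map_zero, LinearMap.zero_apply, Pi.zero_apply]

variable {YU : U →ₗ[ℂ] W →ₗ[ℂ] (ℤ → W)} {YV : V →ₗ[ℂ] W →ₗ[ℂ] (ℤ → W)}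

theorem UniformGood.insert_mode (hYU : ∀ u w, IsLaurent (YU u w))
    (hYV : ∀ v w, IsLaurent (YV v w)) {Sc : ℤ → (U ⊗[ℂ] V →ₗ[ℂ] V ⊗[ℂ] U)}
    (hS : ∀ t, IsTensorLaurent fun n => Sc n t)
    (h2 : ∀ u v w m n, YU u (YV v w n) m = twistRHS YV YU (fun p => Sc p (u ⊗ₜ v)) w m n)
    {Ω : Set W} (hΩ : UniformGood YU Ω) (v : V) (u u' : U) :
    ∃ l N M, ∀ x : Ω × ℤ, Good l N M fun m n => YU u (YV v (YU u' x.1 n) x.2) m := by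
  obtain ⟨T, f, N₀, hf, hT⟩ := (hS (u ⊗ₜ v)).exists_decomp
  obtain ⟨l, N, M, hG⟩ := exists_good_uniform T
    (X := fun s (w : Ω) => prod2 YU YU s.2 u' w) fun s _ => by
      obtain ⟨l, N, M, h⟩ := hΩ s.2 u'
      exact ⟨l, N, M, fun w => h w w.2⟩
  refine ⟨l, N, M, fun ⟨w, r⟩ => ?_⟩
  have e : (fun m n => YU u (YV v (YU u' w n) r) m) = fun m n => ∑ s ∈ T, ∑ᶠ x : ℤ × ℤ,
      expandSub (f s) x.1 x.2 • YV s.1 (YU s.2 (YU u' w n) (m - x.1)) (r - x.2) := by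
    ext m n
    rw [h2, twistRHS_eq hYV hYU hf hT]
  show Good l N M (fun m n => YU u (YV v (YU u' w n) r) m)
  rw [e]
  refine Good.expandSub (Y := fun s x m n => YV s.1 (YU s.2 (YU u' w n) (m - x.1)) (r - x.2))
    (fun s m n => expandSub_support_finite hYV hYU (hf s) _ _ _ _ _) fun s hs x hx => ?_
  convert ((hG s hs w).mulX1 x.1.toNat).map (modeOp YV s.1 (r - x.2)) using 3
  rw [mulX1_pow_apply, Int.toNat_of_nonneg hx]
  rfl

theorem UniformGood.mode (hYU : ∀ u w, IsLaurent (YU u w))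
    (hYV : ∀ v w, IsLaurent (YV v w)) {Sc : ℤ → (U ⊗[ℂ] V →ₗ[ℂ] V ⊗[ℂ] U)}
    (hS : ∀ t, IsTensorLaurent fun n => Sc n t)
    (h2 : ∀ u v w m n, YU u (YV v w n) m = twistRHS YV YU (fun p => Sc p (u ⊗ₜ v)) w m n)
    {Ω : Set W} (hΩ : UniformGood YU Ω) (v : V) :
    UniformGood YU {w' | ∃ w ∈ Ω, ∃ r, w' = YV v w r} := by
  intro u u'
  obtain ⟨T, f, N₀, hf, hT⟩ := (hS (u' ⊗ₜ v)).exists_decomp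
  obtain ⟨l, N, M, hG⟩ := exists_good_uniform T
    (X := fun s (x : Ω × ℤ) m n => YU u (YV s.1 (YU s.2 x.1 n) x.2) m) fun s _ =>
      hΩ.insert_mode hYU hYV hS h2 s.1 u s.2
  refine ⟨l, N, M, ?_⟩
  rintro _ ⟨w, hw, r, rfl⟩
  have e : prod2 YU YU u u' (YV v w r) = fun m n => ∑ s ∈ T, ∑ᶠ x : ℤ × ℤ,
      expandSub (f s) x.1 x.2 • YU u (YV s.1 (YU s.2 w (n - x.1)) (r - x.2)) m := by
    ext m n
    rw [prod2, h2, twistRHS_eq hYV hYU hf hT, ← modeOp_apply, map_sum]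
    refine Finset.sum_congr rfl fun s _ => ?_
    rw [map_finsum _ (expandSub_support_finite hYV hYU (hf s) _ _ _ _ _)]
    simp only [map_smul, modeOp_apply]
  rw [e]
  refine Good.expandSub
    (Y := fun s x m n => YU u (YV s.1 (YU s.2 w (n - x.1)) (r - x.2)) m)
    (fun s m n => ?_) fun s hs x hx => ?_
  · refine (expandSub_support_finite hYV hYU (hf s) s.1 s.2 w n r).subset fun x hx => ?_
    contrapose! hx
    rw [Function.notMem_support] at hx ⊢
    rw [← modeOp_apply, ← map_smul, hx, map_zero]
  · convert (hG s hs (⟨w, hw⟩, r - x.2)).mulX2 x.1.toNat using 3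
    rw [mulX2_pow_apply, Int.toNat_of_nonneg hx]

theorem UniformGood.weakAssoc {𝒰 : NLVA U} (MU : NLVAModule 𝒰 W) {Ω : Set W}
    (hΩ : UniformGood MU.Yw Ω) (u u' : U) : ∃ l N M, (∀ a, a < N → 𝒰.Y u u' a = 0) ∧
      ∀ w ∈ Ω, Good l N M (prod2 MU.Yw MU.Yw u u' w) ∧
        WeakAssoc l (prod2 MU.Yw MU.Yw u u' w) fun a b => MU.Yw (𝒰.Y u u' a) w b := by
  obtain ⟨l, N, M, h⟩ := hΩ u u'
  obtain ⟨N', hN'⟩ := 𝒰.trunc u u'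
  refine ⟨l, min N N', M, fun a ha => hN' a (by omega), fun w hw => ?_⟩
  have hg := (h w hw).mono le_rfl (min_le_left N N') le_rfl
  refine ⟨hg, ?_⟩
  obtain ⟨k, hk⟩ := MU.weak_assoc u u' w
  refine WeakAssoc.descend ((weakAssoc_iff k _ _).2 hk) hg fun a b hab => ?_
  rw [hN' a (by omega), map_zero, LinearMap.zero_apply, Pi.zero_apply]

end Uniform

/-! ### Identification of variables in quadruple series -/

section Diag

variable {W : Type*} [AddCommGroup W] [Module ℂ W]

/-- Identify the third and fourth variables of a quadruple series with the first and second. -/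
def diag2 (τ : ℤ → ℤ → ℤ → ℤ → W) : ℤ → ℤ → W := fun a b =>
  ∑ᶠ x : ℤ × ℤ, τ x.1 x.2 (a - x.1) (b - x.2)

/-- The sums defining `diag2 τ` are finite. -/
def DiagFinite (τ : ℤ → ℤ → ℤ → ℤ → W) : Prop :=
  ∀ a b, (fun x : ℤ × ℤ => τ x.1 x.2 (a - x.1) (b - x.2)).HasFiniteSupport

/-- Apply an operator in the first two variables. -/
def onFst (T : (ℤ → ℤ → W) → ℤ → ℤ → W) (τ : ℤ → ℤ → ℤ → ℤ → W) : ℤ → ℤ → ℤ → ℤ → W :=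
  fun p q m n => T (fun p' q' => τ p' q' m n) p q

/-- Apply an operator in the last two variables. -/
def onSnd (T : (ℤ → ℤ → W) → ℤ → ℤ → W) (τ : ℤ → ℤ → ℤ → ℤ → W) : ℤ → ℤ → ℤ → ℤ → W :=
  fun p q m n => T (τ p q) m n

theorem diagFinite_onSnd_shift {τ : ℤ → ℤ → ℤ → ℤ → W} (h : DiagFinite τ) (i j : ℤ) :
    DiagFinite fun p q m n => τ p q (m - i) (n - j) := by
  intro a b
  convert h (a - i) (b - j) using 3 <;> ring

theorem diagFinite_onFst_shift {τ : ℤ → ℤ → ℤ → ℤ → W} (h : DiagFinite τ) (i j : ℤ) :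
    DiagFinite fun p q m n => τ (p - i) (q - j) m n := by
  intro a b
  have hinj : Function.Injective fun x : ℤ × ℤ => (x.1 - i, x.2 - j) := by
    rintro ⟨x, y⟩ ⟨x', y'⟩ hxy
    simpa using hxy
  refine (Set.Finite.preimage hinj.injOn (h (a - i) (b - j))).subset fun x hx => ?_
  simp only [Set.mem_preimage, Function.mem_support] at hx ⊢
  rwa [sub_sub_sub_cancel_right, sub_sub_sub_cancel_right]

theorem diag2_onSnd_shift (τ : ℤ → ℤ → ℤ → ℤ → W) (i j a b : ℤ) :
    diag2 (fun p q m n => τ p q (m - i) (n - j)) a b = diag2 τ (a - i) (b - j) := by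
  refine finsum_congr fun x => ?_
  rw [sub_right_comm a, sub_right_comm b]

theorem diag2_onFst_shift (τ : ℤ → ℤ → ℤ → ℤ → W) (i j a b : ℤ) :
    diag2 (fun p q m n => τ (p - i) (q - j) m n) a b = diag2 τ (a - i) (b - j) := by
  unfold diag2
  refine Eq.trans ?_ (finsum_comp_equiv ((Equiv.subRight i).prodCongr (Equiv.subRight j)))
  refine finsum_congr fun x => ?_
  simp only [Equiv.prodCongr_apply, Prod.map_fst, Prod.map_snd, Equiv.subRight_apply,
    sub_sub_sub_cancel_right]

theorem DiagFinite.add {τ σ : ℤ → ℤ → ℤ → ℤ → W} (h : DiagFinite τ) (h' : DiagFinite σ) :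
    DiagFinite fun p q m n => τ p q m n + σ p q m n := fun a b =>
  ((h a b).union (h' a b)).subset (Function.support_add _ _)

theorem diag2_add {τ σ : ℤ → ℤ → ℤ → ℤ → W} (h : DiagFinite τ) (h' : DiagFinite σ) :
    (diag2 fun p q m n => τ p q m n + σ p q m n) = diag2 τ + diag2 σ := by
  ext a b
  exact finsum_add_distrib (h a b) (h' a b)

theorem DiagFinite.onFst_mulAdd {τ : ℤ → ℤ → ℤ → ℤ → W} (h : DiagFinite τ) :
    DiagFinite (onFst mulAdd τ) := by
  convert (diagFinite_onFst_shift h 1 0).add (diagFinite_onFst_shift h 0 1) using 5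
  simp [onFst, mulAdd_apply]

theorem DiagFinite.onSnd_mulAdd {τ : ℤ → ℤ → ℤ → ℤ → W} (h : DiagFinite τ) :
    DiagFinite (onSnd mulAdd τ) := by
  convert (diagFinite_onSnd_shift h 1 0).add (diagFinite_onSnd_shift h 0 1) using 5
  simp [onSnd, mulAdd_apply]

theorem diag2_onFst_mulAdd {τ : ℤ → ℤ → ℤ → ℤ → W} (h : DiagFinite τ) :
    diag2 (onFst mulAdd τ) = mulAdd (diag2 τ) := by
  have e : onFst mulAdd τ = fun p q m n => τ (p - 1) (q - 0) m n + τ (p - 0) (q - 1) m n := by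
    ext; simp [onFst, mulAdd_apply]
  rw [e, diag2_add (diagFinite_onFst_shift h 1 0) (diagFinite_onFst_shift h 0 1)]
  ext a b
  rw [Pi.add_apply, Pi.add_apply, diag2_onFst_shift, diag2_onFst_shift, mulAdd_apply, sub_zero, sub_zero]

theorem diag2_onSnd_mulAdd {τ : ℤ → ℤ → ℤ → ℤ → W} (h : DiagFinite τ) :
    diag2 (onSnd mulAdd τ) = mulAdd (diag2 τ) := by
  have e : onSnd mulAdd τ = fun p q m n => τ p q (m - 1) (n - 0) + τ p q (m - 0) (n - 1) := by
    ext; simp [onSnd, mulAdd_apply]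
  rw [e, diag2_add (diagFinite_onSnd_shift h 1 0) (diagFinite_onSnd_shift h 0 1)]
  ext a b
  rw [Pi.add_apply, Pi.add_apply, diag2_onSnd_shift, diag2_onSnd_shift, mulAdd_apply, sub_zero, sub_zero]

theorem diag2_onFst_mulAdd_pow {τ : ℤ → ℤ → ℤ → ℤ → W} (h : DiagFinite τ) (k : ℕ) :
    DiagFinite (onFst (mulAdd ^ k : Module.End ℂ (ℤ → ℤ → W)) τ) ∧
      diag2 (onFst (mulAdd ^ k : Module.End ℂ (ℤ → ℤ → W)) τ) = (mulAdd ^ k) (diag2 τ) := by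
  induction k with
  | zero => exact ⟨h, rfl⟩
  | succ k ih =>
    have e : onFst (mulAdd ^ (k + 1) : Module.End ℂ (ℤ → ℤ → W)) τ
        = onFst mulAdd (onFst (mulAdd ^ k : Module.End ℂ (ℤ → ℤ → W)) τ) := by
      rw [pow_succ']; rfl
    rw [e]
    exact ⟨ih.1.onFst_mulAdd, by
      rw [diag2_onFst_mulAdd ih.1, ih.2, pow_succ', Module.End.mul_apply]⟩

theorem diag2_onSnd_mulAdd_pow {τ : ℤ → ℤ → ℤ → ℤ → W} (h : DiagFinite τ) (k : ℕ) :
    DiagFinite (onSnd (mulAdd ^ k : Module.End ℂ (ℤ → ℤ → W)) τ) ∧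
      diag2 (onSnd (mulAdd ^ k : Module.End ℂ (ℤ → ℤ → W)) τ) = (mulAdd ^ k) (diag2 τ) := by
  induction k with
  | zero => exact ⟨h, rfl⟩
  | succ k ih =>
    have e : onSnd (mulAdd ^ (k + 1) : Module.End ℂ (ℤ → ℤ → W)) τ
        = onSnd mulAdd (onSnd (mulAdd ^ k : Module.End ℂ (ℤ → ℤ → W)) τ) := by
      rw [pow_succ']; rfl
    rw [e]
    exact ⟨ih.1.onSnd_mulAdd, by
      rw [diag2_onSnd_mulAdd ih.1, ih.2, pow_succ', Module.End.mul_apply]⟩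

theorem diag2_lowerBound {τ : ℤ → ℤ → ℤ → ℤ → W} {M M' : ℤ}
    (hq : ∀ p q m n, q < M → τ p q m n = 0) (hn : ∀ p q m n, n < M' → τ p q m n = 0) :
    LowerBound2 (M + M') (diag2 τ) := by
  intro a b hb
  refine finsum_eq_zero_of_forall_eq_zero fun x => ?_
  rcases lt_or_ge x.2 M with h | h
  · exact hq _ _ _ _ h
  · exact hn _ _ _ _ (by omega)

theorem sum_range_prod_eq_sum_antidiagonal {M : Type*} [AddCommMonoid M] (R : ℕ)
    (H : ℕ → ℕ → M) (hH : ∀ i j, R ≤ i + j → H i j = 0) :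
    ∑ i ∈ Finset.range R, ∑ j ∈ Finset.range R, H i j
      = ∑ k ∈ Finset.range R, ∑ x ∈ Finset.HasAntidiagonal.antidiagonal k, H x.1 x.2 := by
  classical
  rw [← Finset.sum_product', ← Finset.sum_filter_of_ne (p := fun x : ℕ × ℕ => x.1 + x.2 < R),
    ← Finset.sum_fiberwise_of_maps_to (t := Finset.range R) (g := fun x : ℕ × ℕ => x.1 + x.2)]
  · refine Finset.sum_congr rfl fun k hk => Finset.sum_congr ?_ fun _ _ => rfl
    ext x
    simp only [Finset.mem_filter, Finset.mem_product, Finset.mem_range,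
      Finset.HasAntidiagonal.mem_antidiagonal] at hk ⊢
    omega
  · intro x hx
    exact Finset.mem_range.2 (Finset.mem_filter.1 hx).2
  · intro x _ hx
    by_contra hc
    exact hx (hH _ _ (by omega))

/-- Substitution `x₁ = x₀ + x₂` commutes with the identification of variables. -/
theorem substAdd02_diag2 {τ : ℤ → ℤ → ℤ → ℤ → W} {M M' : ℤ}
    (hq : ∀ p q m n, q < M → τ p q m n = 0) (hn : ∀ p q m n, n < M' → τ p q m n = 0)
    (hfin : DiagFinite τ) :
    substAdd02 (diag2 τ) = diag2 (onSnd substAdd02 (onFst substAdd02 τ)) := by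
  ext a b
  obtain ⟨R, hR⟩ : ∃ R : ℕ, b - (M + M') < R := ⟨(b - (M + M') + 1).toNat, by omega⟩
  rw [substAdd02_eq_sum (diag2_lowerBound hq hn) a b hR]
  have hinner : ∀ p q m n, q - M < R → onFst substAdd02 τ p q m n
      = ∑ j ∈ Finset.range R, ((zchoose (p + j) j : ℤ) : ℂ) • τ (p + j) (q - j) m n :=
    fun p q m n h => substAdd02_eq_sum (fun p q h => hq p q m n h) p q h
  have hinner0 : ∀ p q m n, n < M' → onFst substAdd02 τ p q m n = 0 := fun p q m n h =>
    finsum_eq_zero_of_forall_eq_zero fun i => by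
      beta_reduce; rw [hn _ _ _ _ h, smul_zero]
  have hinner0' : ∀ p q m n, q < M → onFst substAdd02 τ p q m n = 0 := fun p q m n h =>
    finsum_eq_zero_of_forall_eq_zero fun i => by
      beta_reduce; rw [hq _ _ _ _ (by omega), smul_zero]
  have hx : ∀ x : ℤ × ℤ,
      onSnd substAdd02 (onFst substAdd02 τ) x.1 x.2 (a - x.1) (b - x.2)
      = ∑ i ∈ Finset.range R, ∑ j ∈ Finset.range R,
        (((zchoose (a - x.1 + i) i : ℤ) : ℂ) * ((zchoose (x.1 + j) j : ℤ) : ℂ)) •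
          τ (x.1 + j) (x.2 - j) (a - x.1 + i) (b - x.2 - i) := by
    intro x
    simp only [mul_smul, ← Finset.smul_sum]
    rcases lt_or_ge x.2 M with h1 | h1
    · rw [Finset.sum_eq_zero fun i _ => by
        rw [Finset.sum_eq_zero fun j _ => by rw [hq _ _ _ _ (by omega), smul_zero], smul_zero]]
      exact finsum_eq_zero_of_forall_eq_zero fun i => by rw [hinner0' _ _ _ _ h1, smul_zero]
    rcases lt_or_ge (b - x.2) M' with h2 | h2
    · rw [Finset.sum_eq_zero fun i _ => by
        rw [Finset.sum_eq_zero fun j _ => by rw [hn _ _ _ _ (by omega), smul_zero], smul_zero]]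
      exact finsum_eq_zero_of_forall_eq_zero fun i => by
        rw [hinner0 _ _ _ _ (by omega), smul_zero]
    · refine (substAdd02_eq_sum (R := R) (fun m n h => hinner0 x.1 x.2 m n h) _ _
        (by omega)).trans (Finset.sum_congr rfl fun i _ => ?_)
      rw [hinner _ _ _ _ (by omega)]
  have hshift : ∀ i j : ℕ,
      (fun x : ℤ × ℤ => (((zchoose (a - x.1 + i) i : ℤ) : ℂ) * ((zchoose (x.1 + j) j : ℤ) : ℂ)) •
          τ (x.1 + j) (x.2 - j) (a - x.1 + i) (b - x.2 - i)) = fun x : ℤ × ℤ =>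
        (fun y : ℤ × ℤ =>
          (((zchoose (a + (i + j : ℕ) - y.1) i : ℤ) : ℂ) * ((zchoose y.1 j : ℤ) : ℂ)) •
          τ y.1 y.2 (a + (i + j : ℕ) - y.1) (b - (i + j : ℕ) - y.2))
          (((Equiv.addRight (j : ℤ)).prodCongr (Equiv.subRight (j : ℤ))) x) := by
    intro i j
    ext x
    simp only [Equiv.prodCongr_apply, Prod.map_fst, Prod.map_snd, Equiv.subRight_apply,
      Equiv.coe_addRight]
    have e1 : a + ((i + j : ℕ) : ℤ) - (x.1 + j) = a - x.1 + i := by push_cast; ring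
    have e2 : b - ((i + j : ℕ) : ℤ) - (x.2 - j) = b - x.2 - i := by push_cast; ring
    rw [e1, e2]
  have hf2 : ∀ i j : ℕ, (fun y : ℤ × ℤ =>
      (((zchoose (a + (i + j : ℕ) - y.1) i : ℤ) : ℂ) * ((zchoose y.1 j : ℤ) : ℂ)) •
          τ y.1 y.2 (a + (i + j : ℕ) - y.1) (b - (i + j : ℕ) - y.2)).HasFiniteSupport :=
    fun i j => (hfin (a + (i + j : ℕ)) (b - (i + j : ℕ))).subset
      (Function.support_smul_subset_right _ _)
  have hf1 : ∀ i j : ℕ, (fun x : ℤ × ℤ =>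
      (((zchoose (a - x.1 + i) i : ℤ) : ℂ) * ((zchoose (x.1 + j) j : ℤ) : ℂ)) •
          τ (x.1 + j) (x.2 - j) (a - x.1 + i) (b - x.2 - i)).HasFiniteSupport := by
    intro i j
    rw [hshift]
    exact Set.Finite.preimage (Equiv.injective _).injOn (hf2 i j)
  unfold diag2
  simp only [hx]
  rw [finsum_sum_comm]
  swap
  · intro i _
    refine ((Finset.range R).finite_toSet.biUnion fun j _ => hf1 i j).subset fun y hy => ?_
    obtain ⟨j, hj, h0⟩ := Finset.exists_ne_zero_of_sum_ne_zero (Function.mem_support.1 hy)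
    exact Set.mem_biUnion hj h0
  rw [Finset.sum_congr rfl fun i _ => finsum_sum_comm _ _ fun j _ => hf1 i j]
  have hsum : ∀ i j : ℕ, ∑ᶠ x : ℤ × ℤ,
      (((zchoose (a - x.1 + i) i : ℤ) : ℂ) * ((zchoose (x.1 + j) j : ℤ) : ℂ)) •
          τ (x.1 + j) (x.2 - j) (a - x.1 + i) (b - x.2 - i)
      = ∑ᶠ y : ℤ × ℤ,
          (((zchoose (a + (i + j : ℕ) - y.1) i : ℤ) : ℂ) * ((zchoose y.1 j : ℤ) : ℂ)) •
          τ y.1 y.2 (a + (i + j : ℕ) - y.1) (b - (i + j : ℕ) - y.2) := fun i j => by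
    rw [hshift i j]
    exact finsum_comp_equiv ((Equiv.addRight (j : ℤ)).prodCongr (Equiv.subRight (j : ℤ)))
      (f := fun y : ℤ × ℤ =>
        (((zchoose (a + (i + j : ℕ) - y.1) i : ℤ) : ℂ) * ((zchoose y.1 j : ℤ) : ℂ)) •
          τ y.1 y.2 (a + (i + j : ℕ) - y.1) (b - (i + j : ℕ) - y.2))
  simp only [hsum]
  rw [sum_range_prod_eq_sum_antidiagonal R fun i j => ∑ᶠ y : ℤ × ℤ,
      (((zchoose (a + (i + j : ℕ) - y.1) i : ℤ) : ℂ) * ((zchoose y.1 j : ℤ) : ℂ)) •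
          τ y.1 y.2 (a + (i + j : ℕ) - y.1) (b - (i + j : ℕ) - y.2)]
  · refine Finset.sum_congr rfl fun k _ => ?_
    rw [smul_finsum, ← finsum_sum_comm]
    · refine finsum_congr fun y => ?_
      have e : zchoose (a + k) k = zchoose ((a + k - y.1) + y.1) k := by rw [sub_add_cancel]
      rw [e, zchoose_add, Int.cast_sum, Finset.sum_smul]
      refine Finset.sum_congr rfl fun x hxk => ?_
      rw [Finset.HasAntidiagonal.mem_antidiagonal.1 hxk, Int.cast_mul]
    · exact fun x _ => hf2 x.1 x.2
  · intro i j hij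
    refine finsum_eq_zero_of_forall_eq_zero fun y => ?_
    rcases lt_or_ge y.2 M with h | h
    · rw [hq _ _ _ _ h, smul_zero]
    · rw [hn _ _ _ _ (by push_cast; omega), smul_zero]

end Diag

/-! ### Weak associativity of fourfold products -/

section Quad

variable {U V W : Type*} [AddCommGroup U] [Module ℂ U] [AddCommGroup V] [Module ℂ V]
  [AddCommGroup W] [Module ℂ W]

/-- Coefficients of `Y(u,y₁)Y(u',y₂)Y(v,z₁)Y(v',z₂)w`. -/
def quadProd (YU : U →ₗ[ℂ] W →ₗ[ℂ] (ℤ → W)) (YV : V →ₗ[ℂ] W →ₗ[ℂ] (ℤ → W)) (u u' : U)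
    (v v' : V) (w : W) : ℤ → ℤ → ℤ → ℤ → W := fun p q m n =>
  YU u (YU u' (YV v (YV v' w n) m) q) p

/-- Coefficients of `Y(Y(u,y₁)u',y₂)Y(Y(v,z₁)v',z₂)w`. -/
def quadIter {𝒰 : NLVA U} {𝒱 : NLVA V} (MU : NLVAModule 𝒰 W) (MV : NLVAModule 𝒱 W) (u u' : U)
    (v v' : V) (w : W) : ℤ → ℤ → ℤ → ℤ → W := fun p q m n =>
  MU.Yw (𝒰.Y u u' p) (MV.Yw (𝒱.Y v v' m) w n) q

theorem quadProd_zero_right (YU : U →ₗ[ℂ] W →ₗ[ℂ] (ℤ → W)) (YV : V →ₗ[ℂ] W →ₗ[ℂ] (ℤ → W))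
    (u u' : U) (v v' : V) {w : W} {p q m n : ℤ} (h : YV v (YV v' w n) m = 0) :
    quadProd YU YV u u' v v' w p q m n = 0 := by
  simp [quadProd, h]

section Iter

variable {𝒰 : NLVA U} {𝒱 : NLVA V} {MU : NLVAModule 𝒰 W} {MV : NLVAModule 𝒱 W}

theorem diagFinite_quadIter
    (h1 : ∀ (u : U) (v : V) (w : W), IsLaurent2 fun m n => MU.Yw u (MV.Yw v w n) m)
    (u u' : U) (v v' : V) (w : W) : DiagFinite (quadIter MU MV u u' v v' w) := by
  intro a b
  obtain ⟨N, hN⟩ := 𝒰.trunc u u'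
  obtain ⟨N', hN'⟩ := 𝒱.trunc v v'
  choose c hc using fun p : ℤ => h1 (𝒰.Y u u' p) (𝒱.Y v v' (a - p)) w
  refine finite_of_fiber_bounds N (a - N') c (fun p => b - c p) fun x hx => ?_
  simp only [Function.mem_support, quadIter] at hx
  refine ⟨?_, ?_, ?_, ?_⟩ <;> by_contra! hlt <;> apply hx
  · rw [hN _ hlt]; simp
  · rw [hN' (a - x.1) (by omega)]; simp
  · exact hc x.1 _ _ (Or.inl hlt)
  · exact hc x.1 x.2 (b - x.2) (Or.inr (by omega))

theorem diag2_quadIter_vanish (u u' : U) (v v' : V) (w : W) :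
    ∃ N, ∀ a b, a < N → diag2 (quadIter MU MV u u' v v' w) a b = 0 := by
  obtain ⟨N, hN⟩ := 𝒰.trunc u u'
  obtain ⟨N', hN'⟩ := 𝒱.trunc v v'
  refine ⟨N + N', fun a b h => finsum_eq_zero_of_forall_eq_zero fun x => ?_⟩
  rcases lt_or_ge x.1 N with h' | h'
  · simp [quadIter, hN _ h']
  · simp [quadIter, hN' (a - x.1) (by omega)]

end Iter

section Prod

variable {YU : U →ₗ[ℂ] W →ₗ[ℂ] (ℤ → W)} {YV : V →ₗ[ℂ] W →ₗ[ℂ] (ℤ → W)} {u u' : U} {v v' : V}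
  {w : W} {l : ℕ} {N M : ℤ}

theorem diagFinite_quadProd (hYV : ∀ v w, IsLaurent (YV v w))
    (hg : ∀ m n, Good l N M (prod2 YU YU u u' (YV v (YV v' w n) m))) :
    DiagFinite (quadProd YU YV u u' v v' w) := by
  intro a b
  obtain ⟨n₀, hn₀⟩ := hYV v' w
  choose c hc using fun q : ℤ => hYV v (YV v' w (b - q))
  have hinj : Function.Injective (Prod.swap : ℤ × ℤ → ℤ × ℤ) := Prod.swap_injective
  refine Set.Finite.of_finite_image (f := Prod.swap) ?_ hinj.injOn
  refine finite_of_fiber_bounds M (b - n₀) (fun q => N + M - l - q) (fun q => a - c q) ?_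
  rintro _ ⟨⟨p, q⟩, hx, rfl⟩
  simp only [Function.mem_support] at hx
  simp only [Prod.swap_prod_mk]
  refine ⟨?_, ?_, ?_, ?_⟩ <;> by_contra! hlt <;> apply hx
  · exact (hg (a - p) (b - q)).lower p q hlt
  · exact quadProd_zero_right _ _ _ _ _ _ (by rw [hn₀ (b - q) (by omega)]; simp)
  · exact (hg (a - p) (b - q)).eq_zero (p := p) (q := q) (by omega)
  · exact quadProd_zero_right _ _ _ _ _ _ (hc q (a - p) (by omega))

theorem diag2_quadProd_lowerBound (hYV : ∀ v w, IsLaurent (YV v w))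
    (hg : ∀ m n, Good l N M (prod2 YU YU u u' (YV v (YV v' w n) m))) :
    ∃ M', LowerBound2 M' (diag2 (quadProd YU YV u u' v v' w)) := by
  obtain ⟨n₀, hn₀⟩ := hYV v' w
  exact ⟨M + n₀, diag2_lowerBound (fun p q m n h => (hg m n).lower p q h) fun p q m n h =>
    quadProd_zero_right _ _ _ _ _ _ (by rw [hn₀ n h]; simp)⟩

theorem diag2_quadProd_vanish (hYV : ∀ v w, IsLaurent (YV v w))
    (hg : ∀ m n, Good l N M (prod2 YU YU u u' (YV v (YV v' w n) m))) (n : ℤ) :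
    ∃ c, ∀ m, m < c → diag2 (quadProd YU YV u u' v v' w) m n = 0 := by
  obtain ⟨n₀, hn₀⟩ := hYV v' w
  choose c hc using fun q : ℤ => hYV v (YV v' w (n - q))
  obtain ⟨C, hC⟩ := ((Finset.Icc M (n - n₀)).image fun q => q - c q).exists_le
  refine ⟨N + M - l - C, fun m hm => finsum_eq_zero_of_forall_eq_zero fun x => ?_⟩
  rcases lt_or_ge x.2 M with h | h
  · exact (hg (m - x.1) (n - x.2)).lower _ _ h
  rcases lt_or_ge (n - n₀) x.2 with h' | h'
  · exact quadProd_zero_right _ _ _ _ _ _ (by rw [hn₀ (n - x.2) (by omega)]; simp)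
  have h3 := hC _ (Finset.mem_image_of_mem _ (Finset.mem_Icc.2 ⟨h, h'⟩))
  rcases lt_or_ge (x.1 + x.2) (N + M - l) with h4 | h4
  · exact (hg (m - x.1) (n - x.2)).eq_zero h4
  · exact quadProd_zero_right _ _ _ _ _ _ (hc x.2 (m - x.1) (by omega))

end Prod

section Main

variable {𝒰 : NLVA U} {𝒱 : NLVA V} {MU : NLVAModule 𝒰 W} {MV : NLVAModule 𝒱 W}

theorem weakAssoc_quad
    (h1 : ∀ (u : U) (v : V) (w : W), IsLaurent2 fun m n => MU.Yw u (MV.Yw v w n) m)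
    {u u' : U} {v v' : V} {w : W} {l l' : ℕ} {N M : ℤ}
    (hg : ∀ m n, Good l N M (prod2 MU.Yw MU.Yw u u' (MV.Yw v (MV.Yw v' w n) m)))
    (hU : ∀ m n, WeakAssoc l (prod2 MU.Yw MU.Yw u u' (MV.Yw v (MV.Yw v' w n) m))
      fun a b => MU.Yw (𝒰.Y u u' a) (MV.Yw v (MV.Yw v' w n) m) b)
    (hV : WeakAssoc l' (prod2 MV.Yw MV.Yw v v' w) fun a b => MV.Yw (𝒱.Y v v' a) w b) :
    WeakAssoc (l + l') (diag2 (quadProd MU.Yw MV.Yw u u' v v' w))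
      (diag2 (quadIter MU MV u u' v v' w)) := by
  obtain ⟨n₀, hn₀⟩ := MV.trunc v' w
  have hfin := diagFinite_quadProd MV.trunc hg
  obtain ⟨M', hM'⟩ := diag2_quadProd_lowerBound MV.trunc hg
  have hzfin := diagFinite_quadIter h1 u u' v v' w
  set τ := quadProd MU.Yw MV.Yw u u' v v' w with hτ
  set σ : ℤ → ℤ → ℤ → ℤ → W := fun p q m n => τ (p - l) (q - 0) (m - l') (n - 0) with hσ
  have hσfin : DiagFinite σ :=
    diagFinite_onFst_shift (diagFinite_onSnd_shift hfin l' 0) l 0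
  have hσdiag : diag2 σ = (mulX1 ^ (l + l')) (diag2 τ) := by
    ext a b
    rw [mulX1_pow_apply]
    refine (diag2_onFst_shift (fun p q m n => τ p q (m - l') (n - 0)) l 0 a b).trans ?_
    rw [diag2_onSnd_shift, sub_zero, sub_zero]
    congr 1
    push_cast; ring
  have hlow : LowerBound2 n₀ (prod2 MV.Yw MV.Yw v v' w) := fun m n h => by
    simp [prod2, hn₀ n h]
  unfold WeakAssoc
  rw [← substAdd02_mulX1_pow hM', ← hσdiag,
    substAdd02_diag2 (τ := σ) (M := M) (M' := n₀) (fun p q m n h => (hg _ _).lower _ _ (by omega))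
      (fun p q m n h => quadProd_zero_right _ _ _ _ _ _ (by
        rw [hn₀ (n - 0) (by omega)]; simp)) hσfin, pow_add, Module.End.mul_apply,
    ← (diag2_onSnd_mulAdd_pow hzfin l').2,
    ← (diag2_onFst_mulAdd_pow (diag2_onSnd_mulAdd_pow hzfin l').1 l).2]
  congr 1
  let Λ : ℤ → ℤ → W →ₗ[ℂ] W := (mulAdd ^ l) fun a b => modeOp MU.Yw (𝒰.Y u u' a) b
  have hΛ : ∀ p q x, Λ p q x = (mulAdd ^ l) (fun a b => MU.Yw (𝒰.Y u u' a) x b) p q :=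
    fun p q x => map_mulAdd_pow (LinearMap.applyₗ x) l
      (fun a b => modeOp MU.Yw (𝒰.Y u u' a) b) p q
  have hinner : onFst substAdd02 σ
      = fun p q m n => Λ p q ((mulX1 ^ l') (prod2 MV.Yw MV.Yw v v' w) m n) := by
    ext p q m n
    rw [hΛ, mulX1_pow_apply]
    have h := hU (m - l') n
    unfold WeakAssoc at h
    rw [← substAdd02_mulX1_pow (hg (m - l') n).lower] at h
    rw [prod2, ← h]
    refine congrFun (congrFun (congrArg substAdd02 ?_) p) q
    ext p' q'
    rw [mulX1_pow_apply]
    simp [hσ, hτ, quadProd, prod2]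
  ext p q m n
  rw [hinner]
  have e1 : onSnd substAdd02
      (fun p q m n => Λ p q ((mulX1 ^ l') (prod2 MV.Yw MV.Yw v v' w) m n)) p q m n
      = Λ p q (substAdd02 ((mulX1 ^ l') (prod2 MV.Yw MV.Yw v v' w)) m n) :=
    (map_substAdd02 (Λ p q) (hlow.mulX1_pow l') m n).symm
  rw [e1, substAdd02_mulX1_pow hlow, hV, hΛ]
  refine congrFun (congrFun (congrArg _ ?_) p) q
  ext a b
  exact map_mulAdd_pow (modeOp MU.Yw (𝒰.Y u u' a) b) l'
    (fun a' b' => MV.Yw (𝒱.Y v v' a') w b') m n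

/-- The family of words on which associativity of `Y_W^U` is needed is uniformly good. -/
theorem exists_good_quad
    {Sc : ℤ → (U ⊗[ℂ] V →ₗ[ℂ] V ⊗[ℂ] U)} (hS : ∀ t, IsTensorLaurent fun n => Sc n t)
    (h2 : ∀ u v w m n,
      MU.Yw u (MV.Yw v w n) m = twistRHS MV.Yw MU.Yw (fun p => Sc p (u ⊗ₜ v)) w m n)
    (u u' : U) (v v' : V) (w : W) :
    ∃ l N M, ∀ m n, Good l N M (prod2 MU.Yw MU.Yw u u' (MV.Yw v (MV.Yw v' w n) m)) ∧
      WeakAssoc l (prod2 MU.Yw MU.Yw u u' (MV.Yw v (MV.Yw v' w n) m))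
        fun a b => MU.Yw (𝒰.Y u u' a) (MV.Yw v (MV.Yw v' w n) m) b := by
  have hΩ := ((UniformGood.singleton MU w).mode MU.trunc MV.trunc hS h2 v').mode
    MU.trunc MV.trunc hS h2 v
  obtain ⟨l, N, M, -, h⟩ := hΩ.weakAssoc MU u u'
  exact ⟨l, N, M, fun m n => h _ ⟨_, ⟨w, rfl, n, rfl⟩, m, rfl⟩⟩

end Main

end Quad

/-! ### Multiplication by a power series in `x₂ - x₁` -/

section Conv

variable {W : Type*} [AddCommGroup W] [Module ℂ W]

/-- Multiply a double series by a scalar double series. -/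
def conv (φ : ℤ → ℤ → ℂ) (T : ℤ → ℤ → W) : ℤ → ℤ → W := fun a b =>
  ∑ᶠ x : ℤ × ℤ, φ x.1 x.2 • T (a - x.1) (b - x.2)

/-- Coefficients of `g(-x₁)Z(x₁,x₂)`. -/
def scaleNeg (g : ℤ → ℂ) (Z : ℤ → ℤ → W) : ℤ → ℤ → W := fun a b =>
  ∑ᶠ c : ℤ, ((-1) ^ c * g c) • Z (a - c) b

theorem conv_eq_diag2 (φ : ℤ → ℤ → ℂ) (T : ℤ → ℤ → W) :
    conv φ T = diag2 fun p q m n => φ p q • T m n := rfl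

theorem diagFinite_conv {φ : ℤ → ℤ → ℂ} (hφ : LowerBound2 0 φ)
    (hφ' : ∀ i j, i < 0 → φ i j = 0) {T : ℤ → ℤ → W} {M : ℤ} (hT : LowerBound2 M T)
    (hT' : ∀ n, ∃ c, ∀ m, m < c → T m n = 0) : DiagFinite fun p q m n => φ p q • T m n := by
  intro a b
  choose c hc using hT'
  have hinj : Function.Injective (Prod.swap : ℤ × ℤ → ℤ × ℤ) := Prod.swap_injective
  refine Set.Finite.of_finite_image (f := Prod.swap) ?_ hinj.injOn
  refine finite_of_fiber_bounds 0 (b - M) 0 (fun q => a - c (b - q)) ?_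
  rintro _ ⟨⟨p, q⟩, hx, rfl⟩
  simp only [Function.mem_support] at hx
  simp only [Prod.swap_prod_mk]
  refine ⟨?_, ?_, ?_, ?_⟩ <;> by_contra! hlt <;> apply hx
  · rw [hφ p q hlt, zero_smul]
  · rw [hT _ _ (by omega), smul_zero]
  · rw [hφ' p q hlt, zero_smul]
  · rw [hc _ _ (by omega), smul_zero]

theorem conv_mulX1_pow (φ : ℤ → ℤ → ℂ) (T : ℤ → ℤ → W) (k : ℕ) :
    conv φ ((mulX1 ^ k) T) = (mulX1 ^ k) (conv φ T) := by
  ext a b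
  rw [mulX1_pow_apply]
  refine finsum_congr fun x => ?_
  rw [mulX1_pow_apply, sub_right_comm]

theorem LowerBound2.conv {φ : ℤ → ℤ → ℂ} (hφ : LowerBound2 0 φ) {T : ℤ → ℤ → W} {M : ℤ}
    (hT : LowerBound2 M T) : LowerBound2 M (conv φ T) := by
  rw [conv_eq_diag2, ← zero_add M]
  exact diag2_lowerBound (fun p q m n h => by rw [hφ _ _ h, zero_smul])
    fun p q m n h => by rw [hT _ _ h, smul_zero]

theorem WeakAssoc.conv {g : ℤ → ℂ} (hg : ∀ p, p < 0 → g p = 0) {T Z : ℤ → ℤ → W} {M N : ℤ}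
    {L : ℕ} (hT : LowerBound2 M T) (hT' : ∀ n, ∃ c, ∀ m, m < c → T m n = 0)
    (hZ : ∀ a b, a < N → Z a b = 0) (h : WeakAssoc L T Z) :
    WeakAssoc L (conv (expandSub g) T) (scaleNeg g Z) := by
  have hφ := expandSub_lowerBound hg
  have hφ' : ∀ i j, i < 0 → expandSub g i j = 0 := fun i j hi => expandSub_of_neg g hi j
  have hT1' : ∀ n, ∃ c, ∀ m, m < c → (mulX1 ^ L) T m n = 0 := fun n => by
    obtain ⟨c, hc⟩ := hT' n
    exact ⟨c, fun m hm => by rw [mulX1_pow_apply]; exact hc _ (by omega)⟩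
  have hfin := diagFinite_conv hφ hφ' (hT.mulX1_pow L) hT1'
  have hfinZ : DiagFinite fun p q m n => substAdd02 (expandSub g) p q • Z m n := by
    intro a b
    refine finite_of_fiber_bounds 0 (a - N) 0 0 fun x hx => ?_
    simp only [Function.mem_support, substAdd02_expandSub hg] at hx
    simp only [Pi.zero_apply]
    have h0 : x.2 = 0 := by
      by_contra hc
      exact hx (by rw [if_neg hc, zero_smul])
    refine ⟨?_, ?_, h0.ge, h0.le⟩ <;> by_contra! hlt <;> apply hx
    · rw [if_pos h0, hg _ hlt, mul_zero, zero_smul]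
    · rw [hZ _ _ (by omega), smul_zero]
  have hscale : scaleNeg g Z = diag2 fun p q m n => substAdd02 (expandSub g) p q • Z m n := by
    ext a b
    refine Eq.trans (finsum_congr fun c => ?_) (finsum_comp_of_injective
      (e := fun c : ℤ => (c, (0 : ℤ))) (fun c c' hc => (Prod.ext_iff.1 hc).1) ?_)
    · beta_reduce
      rw [substAdd02_expandSub hg, if_pos rfl, sub_zero]
    · intro y hy
      beta_reduce
      rw [substAdd02_expandSub hg, if_neg, zero_smul]
      intro hy0
      exact hy ⟨y.1, Prod.ext rfl hy0.symm⟩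
  unfold WeakAssoc at h ⊢
  rw [← substAdd02_mulX1_pow hT] at h
  rw [← substAdd02_mulX1_pow (hφ.conv hT), ← conv_mulX1_pow, conv_eq_diag2,
    substAdd02_diag2 (τ := fun p q m n => expandSub g p q • (mulX1 ^ L) T m n) (M := 0) (M' := M)
      (fun p q m n h => by rw [hφ _ _ h, zero_smul])
      (fun p q m n h => by rw [hT.mulX1_pow L _ _ h, smul_zero]) hfin,
    hscale, ← (diag2_onSnd_mulAdd_pow hfinZ L).2]
  congr 1
  have e1 : onFst substAdd02 (fun p q m n => expandSub g p q • (mulX1 ^ L) T m n)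
      = fun p q m n => substAdd02 (expandSub g) p q • (mulX1 ^ L) T m n := by
    ext p q m n
    exact (map_substAdd02 (LinearMap.toSpanSingleton ℂ W ((mulX1 ^ L) T m n)) hφ p q).symm
  ext p q m n
  rw [e1]
  refine (map_substAdd02 (substAdd02 (expandSub g) p q • LinearMap.id)
    (hT.mulX1_pow L) m n).symm.trans ?_
  rw [h]
  exact map_mulAdd_pow (substAdd02 (expandSub g) p q • LinearMap.id) L Z m n

theorem scaleNeg_shift (k : ℕ) (f : ℤ → ℂ) (Z : ℤ → ℤ → W) :
    scaleNeg (fun p => f (p - k)) Z = ((-mulX1) ^ k) (scaleNeg f Z) := by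
  ext a b
  rw [neg_mulX1_pow_apply]
  unfold scaleNeg
  rw [smul_finsum]
  refine Eq.trans ?_ (finsum_comp_equiv (Equiv.subRight (k : ℤ)))
  refine finsum_congr fun c => ?_
  rw [smul_smul, Equiv.subRight_apply, ← mul_assoc]
  have e1 : (-1 : ℂ) ^ c = (-1) ^ k * (-1) ^ (c - k) := by
    rw [← zpow_natCast (-1 : ℂ) k, ← zpow_add₀ (by norm_num)]; congr 1; ring
  rw [← e1, sub_sub_sub_cancel_right]

/-- Multiplication by a power of `x₂ - x₁` can be undone in weak associativity. -/
theorem WeakAssoc.of_mulSub_pow {k L : ℕ} {M : ℤ} {X Z : ℤ → ℤ → W} (hX : LowerBound2 M X)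
    (h : WeakAssoc L ((mulSub ^ k) X) (((-mulX1) ^ k) Z)) : WeakAssoc L X Z := by
  unfold WeakAssoc at h ⊢
  have hcomm : Commute ((mulAdd : Module.End ℂ (ℤ → ℤ → W)) ^ L) ((-mulX1) ^ k) :=
    (commute_mulAdd_mulX1 (W := W)).neg_right.pow_pow L k
  rw [substAdd02_mulSub_pow hX, ← Module.End.mul_apply, hcomm.eq, Module.End.mul_apply,
    ← Module.End.mul_apply (mulAdd ^ L), hcomm.eq, Module.End.mul_apply] at h
  ext a b
  have h' := congrFun (congrFun h (a + k)) b
  rw [neg_mulX1_pow_apply, neg_mulX1_pow_apply, add_sub_cancel_right] at h'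
  exact smul_right_injective W (pow_ne_zero k (by norm_num : (-1 : ℂ) ≠ 0)) h'

theorem WeakAssoc.sum {ι : Type*} (s : Finset ι) {k : ℕ} {M : ι → ℤ} {X Z : ι → ℤ → ℤ → W}
    (hX : ∀ i ∈ s, LowerBound2 (M i) (X i)) (h : ∀ i ∈ s, WeakAssoc k (X i) (Z i)) :
    WeakAssoc k (∑ i ∈ s, X i) (∑ i ∈ s, Z i) := by
  classical
  have key : (∃ M', LowerBound2 M' (∑ i ∈ s, X i)) ∧
      WeakAssoc k (∑ i ∈ s, X i) (∑ i ∈ s, Z i) := by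
    induction s using Finset.induction_on with
    | empty => exact ⟨⟨0, fun _ _ _ => rfl⟩, by
        simp only [Finset.sum_empty, WeakAssoc, substAdd02_zero]⟩
    | insert i s hi ih =>
      obtain ⟨⟨M', hM'⟩, h'⟩ := ih (fun j hj => hX j (Finset.mem_insert_of_mem hj))
        fun j hj => h j (Finset.mem_insert_of_mem hj)
      rw [Finset.sum_insert hi, Finset.sum_insert hi]
      have hi' := hX i (Finset.mem_insert_self i s)
      exact ⟨⟨min (M i) M', (hi'.mono (min_le_left _ _)).add (hM'.mono (min_le_right _ _))⟩,
        WeakAssoc.add hi' hM' (h i (Finset.mem_insert_self i s)) h'⟩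
  exact key.2

end Conv

section DiagSub

variable {W : Type*} [AddCommGroup W] [Module ℂ W]

theorem DiagFinite.sub {τ σ : ℤ → ℤ → ℤ → ℤ → W} (h : DiagFinite τ) (h' : DiagFinite σ) :
    DiagFinite fun p q m n => τ p q m n - σ p q m n := fun a b =>
  ((h a b).union (h' a b)).subset (Function.support_sub _ _)

theorem diag2_sub {τ σ : ℤ → ℤ → ℤ → ℤ → W} (h : DiagFinite τ) (h' : DiagFinite σ) :
    (diag2 fun p q m n => τ p q m n - σ p q m n) = diag2 τ - diag2 σ := by
  ext a b
  exact finsum_sub_distrib (h a b) (h' a b)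

theorem onFst_mulSub (τ : ℤ → ℤ → ℤ → ℤ → W) :
    onFst mulSub τ = fun p q m n => τ (p - 0) (q - 1) m n - τ (p - 1) (q - 0) m n := by
  ext; simp [onFst, mulSub_apply]

theorem onSnd_mulSub (τ : ℤ → ℤ → ℤ → ℤ → W) :
    onSnd mulSub τ = fun p q m n => τ p q (m - 0) (n - 1) - τ p q (m - 1) (n - 0) := by
  ext; simp [onSnd, mulSub_apply]

theorem diag2_onFst_mulSub_pow {τ : ℤ → ℤ → ℤ → ℤ → W} (h : DiagFinite τ) (k : ℕ) :
    DiagFinite (onFst (mulSub ^ k : Module.End ℂ (ℤ → ℤ → W)) τ) ∧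
      diag2 (onFst (mulSub ^ k : Module.End ℂ (ℤ → ℤ → W)) τ) = (mulSub ^ k) (diag2 τ) := by
  induction k with
  | zero => exact ⟨h, rfl⟩
  | succ k ih =>
    have e : onFst (mulSub ^ (k + 1) : Module.End ℂ (ℤ → ℤ → W)) τ
        = onFst mulSub (onFst (mulSub ^ k : Module.End ℂ (ℤ → ℤ → W)) τ) := by
      rw [pow_succ']; rfl
    rw [e, onFst_mulSub, pow_succ', Module.End.mul_apply, ← ih.2]
    have h1 := diagFinite_onFst_shift ih.1 0 1
    have h2 := diagFinite_onFst_shift ih.1 1 0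
    refine ⟨h1.sub h2, ?_⟩
    rw [diag2_sub h1 h2]
    ext a b
    rw [Pi.sub_apply, Pi.sub_apply, diag2_onFst_shift, diag2_onFst_shift, mulSub_apply,
      sub_zero, sub_zero]

theorem diag2_onSnd_mulSub_pow {τ : ℤ → ℤ → ℤ → ℤ → W} (h : DiagFinite τ) (k : ℕ) :
    DiagFinite (onSnd (mulSub ^ k : Module.End ℂ (ℤ → ℤ → W)) τ) ∧
      diag2 (onSnd (mulSub ^ k : Module.End ℂ (ℤ → ℤ → W)) τ) = (mulSub ^ k) (diag2 τ) := by
  induction k with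
  | zero => exact ⟨h, rfl⟩
  | succ k ih =>
    have e : onSnd (mulSub ^ (k + 1) : Module.End ℂ (ℤ → ℤ → W)) τ
        = onSnd mulSub (onSnd (mulSub ^ k : Module.End ℂ (ℤ → ℤ → W)) τ) := by
      rw [pow_succ']; rfl
    rw [e, onSnd_mulSub, pow_succ', Module.End.mul_apply, ← ih.2]
    have h1 := diagFinite_onSnd_shift ih.1 0 1
    have h2 := diagFinite_onSnd_shift ih.1 1 0
    refine ⟨h1.sub h2, ?_⟩
    rw [diag2_sub h1 h2]
    ext a b
    rw [Pi.sub_apply, Pi.sub_apply, diag2_onSnd_shift, diag2_onSnd_shift, mulSub_apply,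
      sub_zero, sub_zero]

theorem map_mulSub_pow {W' : Type*} [AddCommGroup W'] [Module ℂ W'] (f : W →ₗ[ℂ] W') (k : ℕ)
    (X : ℤ → ℤ → W) (a b : ℤ) :
    f ((mulSub ^ k) X a b) = (mulSub ^ k) (fun m n => f (X m n)) a b := by
  induction k generalizing a b with
  | zero => rfl
  | succ k ih =>
    rw [pow_succ', pow_succ', Module.End.mul_apply, Module.End.mul_apply, mulSub_apply,
      mulSub_apply, map_sub, ih, ih]

theorem conv_expandSub_shift {f : ℤ → ℂ} {T : ℤ → ℤ → W}
    (h : DiagFinite fun p q m n => expandSub f p q • T m n) (k : ℕ) :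
    conv (expandSub fun p => f (p - k)) T = (mulSub ^ k) (conv (expandSub f) T) := by
  rw [conv_eq_diag2, conv_eq_diag2, ← (diag2_onFst_mulSub_pow h k).2]
  congr 1
  ext p q m n
  rw [expandSub_shift_pow]
  exact map_mulSub_pow (LinearMap.toSpanSingleton ℂ W (T m n)) k (expandSub f) p q

end DiagSub

/-! ### The vertex operator map on the tensor product -/

section Pair

variable {U V W : Type*} [AddCommGroup U] [Module ℂ U] [AddCommGroup V] [Module ℂ V]
  [AddCommGroup W] [Module ℂ W] {YU : U →ₗ[ℂ] W →ₗ[ℂ] (ℤ → W)}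
  {YV : V →ₗ[ℂ] W →ₗ[ℂ] (ℤ → W)}

/-- The coefficient of `x^n` in `Y(u,x)Y(v,x)w`. -/
def pairCoef (YU : U →ₗ[ℂ] W →ₗ[ℂ] (ℤ → W)) (YV : V →ₗ[ℂ] W →ₗ[ℂ] (ℤ → W)) (u : U) (v : V)
    (w : W) (n : ℤ) : W := ∑ᶠ p : ℤ, YU u (YV v w (n - p)) p

theorem pairCoef_support_finite (h1 : ∀ u v w, IsLaurent2 fun m n => YU u (YV v w n) m)
    (u : U) (v : V) (w : W) (n : ℤ) :
    (fun p : ℤ => YU u (YV v w (n - p)) p).HasFiniteSupport := by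
  obtain ⟨N, hN⟩ := h1 u v w
  refine (Set.finite_Icc N (n - N)).subset fun p hp => ?_
  by_contra hc
  refine hp (hN p (n - p) ?_)
  rw [Set.mem_Icc] at hc
  omega

theorem pairCoef_isLaurent (h1 : ∀ u v w, IsLaurent2 fun m n => YU u (YV v w n) m)
    (u : U) (v : V) (w : W) : IsLaurent (pairCoef YU YV u v w) := by
  obtain ⟨N, hN⟩ := h1 u v w
  exact ⟨N + N, fun n hn => finsum_eq_zero_of_forall_eq_zero fun p => hN p (n - p) (by omega)⟩

/-- The trilinear map `(u, v, w) ↦ Y(u,x)Y(v,x)w`. -/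
def pairMap (h1 : ∀ u v w, IsLaurent2 fun m n => YU u (YV v w n) m) :
    U →ₗ[ℂ] V →ₗ[ℂ] W →ₗ[ℂ] (ℤ → W) :=
  have fin := pairCoef_support_finite h1
  LinearMap.mk₂ ℂ
    (fun u v =>
      { toFun := pairCoef YU YV u v
        map_add' := fun w w' => by
          ext n
          simp only [pairCoef, Pi.add_apply]
          rw [← finsum_add_distrib (fin _ _ _ _) (fin _ _ _ _)]
          simp
        map_smul' := fun c w => by
          ext n
          simp only [pairCoef, Pi.smul_apply, RingHom.id_apply]
          rw [smul_finsum]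
          simp })
    (fun u u' v => by
      ext w n
      simp only [pairCoef, LinearMap.coe_mk, AddHom.coe_mk, LinearMap.add_apply, Pi.add_apply]
      rw [← finsum_add_distrib (fin _ _ _ _) (fin _ _ _ _)]
      simp)
    (fun c u v => by
      ext w n
      simp only [pairCoef, LinearMap.coe_mk, AddHom.coe_mk, LinearMap.smul_apply, Pi.smul_apply]
      rw [smul_finsum]
      simp)
    (fun u v v' => by
      ext w n
      simp only [pairCoef, LinearMap.coe_mk, AddHom.coe_mk, LinearMap.add_apply, Pi.add_apply]
      rw [← finsum_add_distrib (fin _ _ _ _) (fin _ _ _ _)]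
      simp)
    (fun c u v => by
      ext w n
      simp only [pairCoef, LinearMap.coe_mk, AddHom.coe_mk, LinearMap.smul_apply, Pi.smul_apply]
      rw [smul_finsum]
      simp)

/-- The vertex operator map `u ⊗ v ↦ Y(u,x)Y(v,x)` on `U ⊗ V`. -/
def tensorYw (h1 : ∀ u v w, IsLaurent2 fun m n => YU u (YV v w n) m) :
    U ⊗[ℂ] V →ₗ[ℂ] W →ₗ[ℂ] (ℤ → W) := TensorProduct.lift (pairMap h1)

theorem tensorYw_tmul (h1 : ∀ u v w, IsLaurent2 fun m n => YU u (YV v w n) m) (u : U) (v : V)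
    (w : W) (n : ℤ) : tensorYw h1 (u ⊗ₜ v) w n = pairCoef YU YV u v w n := rfl

theorem IsLaurent.add {V : Type*} [AddCommGroup V] [Module ℂ V] {a b : ℤ → V}
    (ha : IsLaurent a) (hb : IsLaurent b) : IsLaurent (a + b) := by
  obtain ⟨N, hN⟩ := ha
  obtain ⟨N', hN'⟩ := hb
  exact ⟨min N N', fun n hn => by
    rw [Pi.add_apply, hN n (by omega), hN' n (by omega), add_zero]⟩

theorem tensorYw_isLaurent (h1 : ∀ u v w, IsLaurent2 fun m n => YU u (YV v w n) m)
    (t : U ⊗[ℂ] V) (w : W) : IsLaurent (tensorYw h1 t w) := by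
  induction t with
  | zero => exact ⟨0, fun n _ => by simp⟩
  | tmul u v => exact pairCoef_isLaurent h1 u v w
  | add t t' h h' =>
    rw [map_add, LinearMap.add_apply]
    exact h.add h'

end Pair

/-! ### Products of two tensor vertex operators -/

section PairProd

variable {U V W : Type*} [AddCommGroup U] [Module ℂ U] [AddCommGroup V] [Module ℂ V]
  [AddCommGroup W] [Module ℂ W] {YU : U →ₗ[ℂ] W →ₗ[ℂ] (ℤ → W)}
  {YV : V →ₗ[ℂ] W →ₗ[ℂ] (ℤ → W)}

/-- Coefficients of `Y(u,y₁)Y(v,z₁)Y(u',z₂)Y(v',y₂)w`, in the order `y₁, y₂, z₁, z₂`. -/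
def pairQuad (YU : U →ₗ[ℂ] W →ₗ[ℂ] (ℤ → W)) (YV : V →ₗ[ℂ] W →ₗ[ℂ] (ℤ → W)) (u u' : U)
    (v v' : V) (w : W) : ℤ → ℤ → ℤ → ℤ → W := fun p q m n =>
  YU u (YV v (YU u' (YV v' w q) n) m) p

theorem diagFinite_pairQuad (h1 : ∀ u v w, IsLaurent2 fun m n => YU u (YV v w n) m)
    (u u' : U) (v v' : V) (w : W) : DiagFinite (pairQuad YU YV u u' v v' w) := by
  intro a b
  obtain ⟨N, hN⟩ := h1 u' v' w
  choose c hc using fun q : ℤ => h1 u v (YU u' (YV v' w q) (b - q))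
  have hinj : Function.Injective (Prod.swap : ℤ × ℤ → ℤ × ℤ) := Prod.swap_injective
  refine Set.Finite.of_finite_image (f := Prod.swap) ?_ hinj.injOn
  refine finite_of_fiber_bounds N (b - N) c (fun q => a - c q) ?_
  rintro _ ⟨⟨p, q⟩, hx, rfl⟩
  simp only [Function.mem_support, pairQuad] at hx
  simp only [Prod.swap_prod_mk]
  refine ⟨?_, ?_, ?_, ?_⟩ <;> by_contra! hlt <;> apply hx
  · have h0 : YU u' (YV v' w q) (b - q) = 0 := hN (b - q) q (Or.inr hlt)
    rw [h0]; simp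
  · have h0 : YU u' (YV v' w q) (b - q) = 0 := hN (b - q) q (Or.inl (by omega))
    rw [h0]; simp
  · exact hc q p (a - p) (Or.inl hlt)
  · exact hc q p (a - p) (Or.inr (by omega))

theorem diag2_pairQuad (h1 : ∀ u v w, IsLaurent2 fun m n => YU u (YV v w n) m)
    (u u' : U) (v v' : V) (w : W) (a b : ℤ) :
    diag2 (pairQuad YU YV u u' v v' w) a b
      = pairCoef YU YV u v (pairCoef YU YV u' v' w b) a := by
  unfold diag2
  rw [finsum_curry _ (diagFinite_pairQuad h1 u u' v v' w a b)]
  refine finsum_congr fun p => ?_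
  have e : pairCoef YU YV u' v' w b = ∑ᶠ q : ℤ, YU u' (YV v' w q) (b - q) := by
    refine Eq.trans ?_ (finsum_comp_equiv (Equiv.subLeft b))
    exact finsum_congr fun q => by simp
  have hfin : (fun q : ℤ => YU u' (YV v' w q) (b - q)).HasFiniteSupport := by
    refine ((pairCoef_support_finite h1 u' v' w b).preimage
      (Equiv.subLeft b).injective.injOn).subset fun q hq => ?_
    simpa using hq
  rw [e]
  exact (map_finsum (modeOp YU u p ∘ₗ modeOp YV v (a - p)) hfin).symm

theorem exists_lowerBound2_pair (h1 : ∀ u v w, IsLaurent2 fun m n => YU u (YV v w n) m)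
    (u u' : U) (v v' : V) (w : W) :
    ∃ M, LowerBound2 M fun m n => pairCoef YU YV u v (pairCoef YU YV u' v' w n) m := by
  obtain ⟨N, hN⟩ := pairCoef_isLaurent h1 u' v' w
  refine ⟨N, fun m n hn => ?_⟩
  beta_reduce
  rw [hN n hn]
  simp [pairCoef]

/-- The quadruple sums `conv φ (diag2 (quadProd …))` may be reordered. -/
theorem conv_quad_support_finite (hYV : ∀ v w, IsLaurent (YV v w)) {u u' : U} {v v' : V}
    {w : W} {l : ℕ} {N M : ℤ}
    (hg : ∀ m n, Good l N M (prod2 YU YU u u' (YV v (YV v' w n) m))) {φ : ℤ → ℤ → ℂ}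
    (hφ : LowerBound2 0 φ) (hφ' : ∀ i j, i < 0 → φ i j = 0) (a b : ℤ) :
    (fun z : (ℤ × ℤ) × (ℤ × ℤ) => φ z.2.1 z.2.2 •
      quadProd YU YV u u' v v' w z.1.1 (b - z.1.2 - z.2.2) (a - z.1.1 - z.2.1)
        z.1.2).HasFiniteSupport := by
  obtain ⟨n₀, hn₀⟩ := hYV v' w
  choose c hc using fun q : ℤ => hYV v (YV v' w q)
  obtain ⟨C, hC⟩ := ((Finset.Icc n₀ (b - M)).image fun q => -c q).exists_le
  set P := N + M - l - b + n₀
  refine (Set.finite_Icc ((P, n₀), ((0 : ℤ), (0 : ℤ)))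
    ((a + C, b - M), (a + C - P, b - n₀ - M))).subset ?_
  rintro ⟨⟨p, q⟩, i, j⟩ hx
  simp only [Function.mem_support] at hx
  have hi : 0 ≤ i := by
    by_contra! h
    exact hx (by rw [hφ' _ _ h, zero_smul])
  have hj : 0 ≤ j := by
    by_contra! h
    exact hx (by rw [hφ _ _ h, zero_smul])
  have hq : n₀ ≤ q := by
    by_contra! h
    exact hx (by rw [quadProd_zero_right _ _ _ _ _ _ (by rw [hn₀ q h]; simp), smul_zero])
  have hM : M ≤ b - q - j := by
    by_contra! h
    exact hx (smul_eq_zero_of_right _ ((hg (a - p - i) q).lower _ _ h))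
  have hcq : c q ≤ a - p - i := by
    by_contra! h
    exact hx (by rw [quadProd_zero_right _ _ _ _ _ _ (hc q _ h), smul_zero])
  have hp : N + M - l ≤ p + (b - q - j) := by
    by_contra! h
    exact hx (smul_eq_zero_of_right _ ((hg (a - p - i) q).eq_zero h))
  have hCq := hC _ (Finset.mem_image_of_mem _ (Finset.mem_Icc.2 ⟨hq, by omega⟩))
  simp only [Set.mem_Icc, Prod.mk_le_mk]
  omega

theorem conv_diag2_quadProd (hYV : ∀ v w, IsLaurent (YV v w)) {u u' : U} {v v' : V}
    {w : W} {l : ℕ} {N M : ℤ}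
    (hg : ∀ m n, Good l N M (prod2 YU YU u u' (YV v (YV v' w n) m))) {φ : ℤ → ℤ → ℂ}
    (hφ : LowerBound2 0 φ) (hφ' : ∀ i j, i < 0 → φ i j = 0) (a b : ℤ) :
    conv φ (diag2 (quadProd YU YV u u' v v' w)) a b
      = ∑ᶠ (y : ℤ × ℤ) (x : ℤ × ℤ), φ x.1 x.2 •
          quadProd YU YV u u' v v' w y.1 (b - y.2 - x.2) (a - y.1 - x.1) y.2 := by
  rw [finsum_swap _ (conv_quad_support_finite hYV hg hφ hφ' a b)]
  refine finsum_congr fun x => ?_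
  unfold diag2
  rw [← smul_finsum]
  congr 1
  refine Eq.trans (finsum_congr fun y => ?_)
    (finsum_comp_equiv ((Equiv.refl ℤ).prodCongr (Equiv.subLeft (b - x.2))))
  simp only [Equiv.prodCongr_apply, Prod.map_fst, Prod.map_snd, Equiv.subLeft_apply,
    Equiv.refl_apply]
  have e : b - (b - y.2 - x.2) - x.2 = y.2 := by ring
  rw [sub_right_comm a, sub_right_comm b, e]

variable {T : Finset (U × V)} {f : U × V → ℤ → ℂ} {N₀ : ℤ} {k : ℕ}

/-- Normal ordering of `Y(u,x₁)Y(v,x₁)Y(u',x₂)Y(v',x₂)w`. -/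
theorem mulSub_pow_pair (hYU : ∀ u w, IsLaurent (YU u w)) (hYV : ∀ v w, IsLaurent (YV v w))
    (h1 : ∀ u v w, IsLaurent2 fun m n => YU u (YV v w n) m)
    (hf : ∀ s p, p < N₀ → f s p = 0) (hk : 0 ≤ N₀ + k) {q : ℤ → U ⊗[ℂ] V}
    (hq : ∀ p, q p = ∑ s ∈ T, f s p • (s.1 ⊗ₜ[ℂ] s.2)) {u u' : U} {v v' : V} {w : W}
    (h3 : ∀ w, (mulSub ^ k) (fun a b => YV v (YU u' w b) a)
      = (mulSub ^ k) (twistRHS YU YV q w))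
    (hg : ∀ s ∈ T, ∃ l N M,
      ∀ m n, Good l N M (prod2 YU YU u s.1 (YV s.2 (YV v' w n) m))) :
    (mulSub ^ k) (fun m n => pairCoef YU YV u v (pairCoef YU YV u' v' w n) m)
      = ∑ s ∈ T, conv (expandSub fun p => f s (p - k))
          (diag2 (quadProd YU YV u s.1 s.2 v' w)) := by
  have hgs : ∀ s p, p < 0 → f s (p - k) = 0 := fun s p hp => hf s _ (by omega)
  have hφ := fun s => expandSub_lowerBound (hgs s)
  have hφ' : ∀ s i j, i < 0 → expandSub (fun p => f s (p - k)) i j = 0 :=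
    fun s i j hi => expandSub_of_neg _ hi j
  have e1 : (fun m n => pairCoef YU YV u v (pairCoef YU YV u' v' w n) m)
      = diag2 (pairQuad YU YV u u' v v' w) := by
    ext m n
    exact (diag2_pairQuad h1 u u' v v' w m n).symm
  have key : ∀ ω : W, (mulSub ^ k) (twistRHS YU YV q ω) = ∑ s ∈ T,
      conv (expandSub fun p => f s (p - k)) fun a b => YU s.1 (YV s.2 ω a) b := by
    intro ω
    have e2 : twistRHS YU YV q ω = ∑ s ∈ T,
        conv (expandSub (f s)) fun a b => YU s.1 (YV s.2 ω a) b := by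
      ext m n
      rw [twistRHS_eq hYU hYV hf hq]
      simp [Finset.sum_apply, conv]
    rw [e2, map_sum]
    refine Finset.sum_congr rfl fun s _ => ?_
    exact (conv_expandSub_shift (fun m n =>
      expandSub_support_finite hYU hYV (hf s) s.1 s.2 ω m n) k).symm
  rw [e1, ← (diag2_onSnd_mulSub_pow (diagFinite_pairQuad h1 u u' v v' w) k).2]
  ext a b
  rw [Finset.sum_apply, Finset.sum_apply]
  have e3 : ∀ y : ℤ × ℤ, onSnd (mulSub ^ k : Module.End ℂ (ℤ → ℤ → W))
      (pairQuad YU YV u u' v v' w) y.1 y.2 (a - y.1) (b - y.2)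
      = ∑ s ∈ T, ∑ᶠ x : ℤ × ℤ, expandSub (fun p => f s (p - k)) x.1 x.2 •
          quadProd YU YV u s.1 s.2 v' w y.1 (b - y.2 - x.2) (a - y.1 - x.1) y.2 := by
    intro y
    have e4 := map_mulSub_pow (modeOp YU u y.1) k
      (fun m n => YV v (YU u' (YV v' w y.2) n) m) (a - y.1) (b - y.2)
    refine e4.symm.trans ?_
    rw [h3, key, Finset.sum_apply, Finset.sum_apply, map_sum]
    refine Finset.sum_congr rfl fun s _ => ?_
    refine (map_finsum _ (expandSub_support_finite hYU hYV (f := fun p => f s (p - k))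
      (hgs s) s.1 s.2 (YV v' w y.2) (a - y.1) (b - y.2))).trans ?_
    refine finsum_congr fun x => ?_
    rw [map_smul]
    rfl
  unfold diag2
  simp only [e3]
  rw [finsum_sum_comm]
  · refine Finset.sum_congr rfl fun s hs => ?_
    obtain ⟨l, N, M, hgd⟩ := hg s hs
    exact (conv_diag2_quadProd hYV hgd (hφ s) (hφ' s) a b).symm
  · intro s hs
    obtain ⟨l, N, M, hgd⟩ := hg s hs
    refine ((conv_quad_support_finite hYV hgd (hφ s) (hφ' s) a b).image Prod.fst).subset
      fun y hy => ?_
    by_contra! h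
    refine hy (finsum_eq_zero_of_forall_eq_zero fun x => ?_)
    by_contra hx
    exact h ⟨(y, x), hx, rfl⟩

end PairProd

/-! ### Weak associativity on the tensor product -/

section Construct

variable {U V W : Type*} [AddCommGroup U] [Module ℂ U] [AddCommGroup V] [Module ℂ V]
  [AddCommGroup W] [Module ℂ W] {𝒰 : NLVA U} {𝒱 : NLVA V} {MU : NLVAModule 𝒰 W}
  {MV : NLVAModule 𝒱 W}

theorem mulSub_pow_eq_mono {k k' : ℕ} (hk : k ≤ k') {X Z : ℤ → ℤ → W}
    (h : (mulSub ^ k) X = (mulSub ^ k) Z) : (mulSub ^ k') X = (mulSub ^ k') Z := by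
  obtain ⟨j, rfl⟩ := Nat.exists_eq_add_of_le' hk
  rw [pow_add, Module.End.mul_apply, Module.End.mul_apply, h]

theorem exists_weakAssoc_pair {Sc : ℤ → (U ⊗[ℂ] V →ₗ[ℂ] V ⊗[ℂ] U)}
    (hS : ∀ t, IsTensorLaurent fun n => Sc n t)
    (h1 : ∀ (u : U) (v : V) (w : W), IsLaurent2 fun m n => MU.Yw u (MV.Yw v w n) m)
    (h2 : ∀ u v w m n,
      MU.Yw u (MV.Yw v w n) m = twistRHS MV.Yw MU.Yw (fun p => Sc p (u ⊗ₜ v)) w m n)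
    {q : ℤ → U ⊗[ℂ] V} {T : Finset (U × V)} {f : U × V → ℤ → ℂ} {N₀ : ℤ}
    (hf : ∀ s p, p < N₀ → f s p = 0)
    (hq : ∀ p, q p = ∑ s ∈ T, f s p • (s.1 ⊗ₜ[ℂ] s.2)) (u u' : U) (v v' : V) (w : W) {k : ℕ}
    (h3 : ∀ w, (mulSub ^ k) (fun a b => MV.Yw v (MU.Yw u' w b) a)
      = (mulSub ^ k) (twistRHS MU.Yw MV.Yw q w)) :
    ∃ L, WeakAssoc L
      (fun m n => pairCoef MU.Yw MV.Yw u v (pairCoef MU.Yw MV.Yw u' v' w n) m)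
      (∑ s ∈ T, scaleNeg (f s) (diag2 (quadIter MU MV u s.1 s.2 v' w))) := by
  obtain ⟨K, hkK, hK⟩ : ∃ K : ℕ, k ≤ K ∧ 0 ≤ N₀ + K :=
    ⟨max k (-N₀).toNat, le_max_left _ _, by omega⟩
  choose l N M hg using fun s : U × V => exists_good_quad hS h2 u s.1 s.2 v' w
  choose l' hl' using fun s : U × V => MV.weak_assoc s.2 v' w
  have hg1 := fun s m n => (hg s m n).1
  choose M' hM' using fun s => diag2_quadProd_lowerBound MV.trunc (hg1 s)
  choose Nz hNz using fun s : U × V =>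
    diag2_quadIter_vanish (MU := MU) (MV := MV) u s.1 s.2 v' w
  obtain ⟨L, hL⟩ := (T.image fun s => l s + l' s).exists_le
  obtain ⟨MX, hMX⟩ := exists_lowerBound2_pair h1 u u' v v' w
  refine ⟨L, WeakAssoc.of_mulSub_pow hMX (k := K) ?_⟩
  have hgs : ∀ s p, p < 0 → f s (p - K) = 0 := fun s p hp => hf s _ (by omega)
  have e : ((-mulX1) ^ K) (∑ s ∈ T, scaleNeg (f s) (diag2 (quadIter MU MV u s.1 s.2 v' w)))
      = ∑ s ∈ T, scaleNeg (fun p => f s (p - K)) (diag2 (quadIter MU MV u s.1 s.2 v' w)) := by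
    rw [map_sum]
    exact Finset.sum_congr rfl fun s _ => (scaleNeg_shift K (f s) _).symm
  rw [mulSub_pow_pair MU.trunc MV.trunc h1 hf hK hq (fun w => mulSub_pow_eq_mono hkK (h3 w))
    fun s _ => ⟨l s, N s, M s, hg1 s⟩, e]
  refine WeakAssoc.sum T (fun s _ => LowerBound2.conv (expandSub_lowerBound (hgs s)) (hM' s))
    fun s hs => ?_
  refine WeakAssoc.conv (hgs s) (hM' s) (diag2_quadProd_vanish MV.trunc (hg1 s)) (hNz s) ?_
  exact (weakAssoc_quad h1 (hg1 s) (fun m n => (hg s m n).2)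
    ((weakAssoc_iff _ _ _).2 (hl' s))).mono (hL _ (Finset.mem_image_of_mem _ hs))

/-- The coefficient of `x^n` in `Y(u,x)u' ⊗ Y(v,x)v'`. -/
def tensorDiag (𝒰 : NLVA U) (𝒱 : NLVA V) (u u' : U) (v v' : V) (n : ℤ) : U ⊗[ℂ] V :=
  ∑ᶠ a : ℤ, 𝒰.Y u u' a ⊗ₜ 𝒱.Y v v' (n - a)

theorem tensorDiag_support_finite (u u' : U) (v v' : V) (n : ℤ) :
    (fun a : ℤ => (𝒰.Y u u' a ⊗ₜ[ℂ] 𝒱.Y v v' (n - a) : U ⊗[ℂ] V)).HasFiniteSupport := by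
  obtain ⟨N, hN⟩ := 𝒰.trunc u u'
  obtain ⟨N', hN'⟩ := 𝒱.trunc v v'
  refine (Set.finite_Icc N (n - N')).subset fun a ha => ?_
  rw [Function.mem_support] at ha
  constructor <;> by_contra! h <;> apply ha
  · rw [hN a h, TensorProduct.zero_tmul]
  · rw [hN' _ (by omega), TensorProduct.tmul_zero]

theorem exists_tensorDiag_vanish (𝒰 : NLVA U) (𝒱 : NLVA V) (u u' : U) (v v' : V) :
    ∃ N, ∀ n, n < N → tensorDiag 𝒰 𝒱 u u' v v' n = 0 := by
  obtain ⟨N, hN⟩ := 𝒰.trunc u u'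
  obtain ⟨N', hN'⟩ := 𝒱.trunc v v'
  refine ⟨N + N', fun n hn => finsum_eq_zero_of_forall_eq_zero fun a => ?_⟩
  rcases lt_or_ge a N with h | h
  · rw [hN a h, TensorProduct.zero_tmul]
  · rw [hN' _ (by omega), TensorProduct.tmul_zero]

theorem tensorYw_tensorDiag
    (h1 : ∀ (u : U) (v : V) (w : W), IsLaurent2 fun m n => MU.Yw u (MV.Yw v w n) m)
    (u u' : U) (v v' : V) (w : W) (a b : ℤ) :
    tensorYw h1 (tensorDiag 𝒰 𝒱 u u' v v' a) w b
      = diag2 (quadIter MU MV u u' v v' w) a b := by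
  unfold diag2
  rw [finsum_curry _ (diagFinite_quadIter h1 u u' v v' w a b)]
  refine ((map_finsum ((LinearMap.proj b).comp ((tensorYw h1).flip w))
    (tensorDiag_support_finite u u' v v' a)).trans ?_)
  exact finsum_congr fun p => rfl

theorem scaleNeg_tensorDiag_support_finite {g : ℤ → ℂ} {N₀ : ℤ} (hg : ∀ p, p < N₀ → g p = 0)
    (u u' : U) (v v' : V) (n : ℤ) :
    (fun c : ℤ => ((-1 : ℂ) ^ c * g c) •
      tensorDiag 𝒰 𝒱 u u' v v' (n - c)).HasFiniteSupport := by
  obtain ⟨N, hN⟩ := exists_tensorDiag_vanish 𝒰 𝒱 u u' v v'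
  refine (Set.finite_Icc N₀ (n - N)).subset fun c hc => ?_
  rw [Function.mem_support] at hc
  constructor <;> by_contra! h <;> apply hc
  · rw [hg c h, mul_zero, zero_smul]
  · rw [hN _ (by omega), smul_zero]

theorem YRcoef_eq {Rop : TwistingOp 𝒰 𝒱} {T : Finset (U × V)} {f : U × V → ℤ → ℂ} {N₀ : ℤ}
    (hf : ∀ s p, p < N₀ → f s p = 0) {u u' : U} {v v' : V}
    (hq : ∀ p, Rop.Rc p (v ⊗ₜ u') = ∑ s ∈ T, f s p • (s.1 ⊗ₜ[ℂ] s.2)) (n : ℤ) :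
    YRcoef 𝒰 𝒱 Rop u v u' v' n
      = ∑ s ∈ T, ∑ᶠ c : ℤ, ((-1) ^ c * f s c) • tensorDiag 𝒰 𝒱 u s.1 s.2 v' (n - c) := by
  rw [← finsum_sum_comm T _ fun s _ => ?_]
  · refine finsum_congr fun c => ?_
    have e : ∀ a : ℤ, ((-1 : ℂ) ^ c) •
        (TensorProduct.map (𝒰.Yc a u) ((𝒱.Yc (n - c - a)).flip v')) (Rop.Rc c (v ⊗ₜ u'))
        = ∑ s ∈ T, ((-1) ^ c * f s c) • (𝒰.Y u s.1 a ⊗ₜ[ℂ] 𝒱.Y s.2 v' (n - c - a)) := by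
      intro a
      rw [hq, map_sum, Finset.smul_sum]
      refine Finset.sum_congr rfl fun s _ => ?_
      rw [map_smul, smul_smul]
      rfl
    simp only [e]
    refine (finsum_sum_comm T _ fun s _ =>
      (tensorDiag_support_finite u s.1 s.2 v' (n - c)).subset fun a ha h0 =>
        ha (smul_eq_zero_of_right _ h0)).trans ?_
    exact Finset.sum_congr rfl fun s _ => (smul_finsum _ _).symm
  · exact scaleNeg_tensorDiag_support_finite (hf s) u s.1 s.2 v' n

theorem tensorYw_YRcoef {Rop : TwistingOp 𝒰 𝒱}
    (h1 : ∀ (u : U) (v : V) (w : W), IsLaurent2 fun m n => MU.Yw u (MV.Yw v w n) m)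
    {T : Finset (U × V)} {f : U × V → ℤ → ℂ} {N₀ : ℤ}
    (hf : ∀ s p, p < N₀ → f s p = 0) {u u' : U} {v v' : V}
    (hq : ∀ p, Rop.Rc p (v ⊗ₜ u') = ∑ s ∈ T, f s p • (s.1 ⊗ₜ[ℂ] s.2)) (w : W) (a b : ℤ) :
    tensorYw h1 (YRcoef 𝒰 𝒱 Rop u v u' v' a) w b
      = (∑ s ∈ T, scaleNeg (f s) (diag2 (quadIter MU MV u s.1 s.2 v' w))) a b := by
  rw [YRcoef_eq hf hq, Finset.sum_apply, Finset.sum_apply]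
  refine (map_sum ((LinearMap.proj b).comp ((tensorYw h1).flip w)) _ _).trans
    (Finset.sum_congr rfl fun s _ => ?_)
  refine (map_finsum _ (scaleNeg_tensorDiag_support_finite (hf s) u s.1 s.2 v' a)).trans
    (finsum_congr fun c => ?_)
  rw [map_smul, ← tensorYw_tensorDiag h1]
  rfl

end Construct

section TensorModule

variable {U V W : Type*} [AddCommGroup U] [Module ℂ U] [AddCommGroup V] [Module ℂ V]
  [AddCommGroup W] [Module ℂ W] {𝒰 : NLVA U} {𝒱 : NLVA V} {MU : NLVAModule 𝒰 W}
  {MV : NLVAModule 𝒱 W}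

theorem pairCoef_one_right (u : U) (w : W) (n : ℤ) :
    pairCoef MU.Yw MV.Yw u 𝒱.one w n = MU.Yw u w n := by
  unfold pairCoef
  rw [finsum_eq_single _ n fun p hp => ?_]
  · rw [MV.vacuum, if_pos (sub_self n)]
  · rw [MV.vacuum, if_neg (sub_ne_zero.2 hp.symm), map_zero, Pi.zero_apply]

theorem pairCoef_one_left (v : V) (w : W) (n : ℤ) :
    pairCoef MU.Yw MV.Yw 𝒰.one v w n = MV.Yw v w n := by
  unfold pairCoef
  rw [finsum_eq_single _ 0 fun p hp => ?_]
  · rw [MU.vacuum, if_pos rfl, sub_zero]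
  · rw [MU.vacuum, if_neg hp]

theorem tensorYw_prod_lowerBound
    (h1 : ∀ (u : U) (v : V) (w : W), IsLaurent2 fun m n => MU.Yw u (MV.Yw v w n) m)
    (t t' : U ⊗[ℂ] V) (w : W) :
    ∃ M, LowerBound2 M fun m n => tensorYw h1 t (tensorYw h1 t' w n) m := by
  obtain ⟨N, hN⟩ := tensorYw_isLaurent h1 t' w
  refine ⟨N, fun m n hn => ?_⟩
  beta_reduce
  rw [hN n hn, map_zero, Pi.zero_apply]

variable {Rop : TwistingOp 𝒰 𝒱} {𝒯 : NLVA (U ⊗[ℂ] V)}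

theorem tensorYw_weakAssoc (h𝒯 : IsTwistedTensor 𝒰 𝒱 Rop 𝒯)
    {Sc : ℤ → (U ⊗[ℂ] V →ₗ[ℂ] V ⊗[ℂ] U)} (hS : ∀ t, IsTensorLaurent fun n => Sc n t)
    (h1 : ∀ (u : U) (v : V) (w : W), IsLaurent2 fun m n => MU.Yw u (MV.Yw v w n) m)
    (h2 : ∀ u v w m n,
      MU.Yw u (MV.Yw v w n) m = twistRHS MV.Yw MU.Yw (fun p => Sc p (u ⊗ₜ v)) w m n)
    (h3 : ∀ (u : U) (v : V), ∃ k : ℕ, ∀ (w : W) (m n : ℤ),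
      mulSubPow' k (fun a b => MV.Yw v (MU.Yw u w b) a) m n
        = mulSubPow' k (twistRHS MU.Yw MV.Yw (fun p => Rop.Rc p (v ⊗ₜ u)) w) m n)
    (t t' : U ⊗[ℂ] V) (w : W) :
    ∃ k, WeakAssoc k (fun m n => tensorYw h1 t (tensorYw h1 t' w n) m)
      fun a b => tensorYw h1 (𝒯.Y t t' a) w b := by
  have hlow := fun t t' => tensorYw_prod_lowerBound h1 t t' w
  have hzero : WeakAssoc 0 (0 : ℤ → ℤ → W) 0 := by rw [WeakAssoc, substAdd02_zero]
  induction t with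
  | zero =>
    refine ⟨0, ?_⟩
    convert hzero using 1 <;> ext <;> simp
  | add t s ht hs =>
    obtain ⟨k, hk⟩ := ht
    obtain ⟨j, hj⟩ := hs
    obtain ⟨M, hM⟩ := hlow t t'
    obtain ⟨M', hM'⟩ := hlow s t'
    refine ⟨max k j, ?_⟩
    convert WeakAssoc.add hM hM' (hk.mono (le_max_left k j)) (hj.mono (le_max_right k j)) using 1
      <;> ext <;> simp
  | tmul u v =>
    induction t' with
    | zero =>
      refine ⟨0, ?_⟩
      convert hzero using 1 <;> ext <;> simp
    | add t s ht hs =>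
      obtain ⟨k, hk⟩ := ht
      obtain ⟨j, hj⟩ := hs
      obtain ⟨M, hM⟩ := hlow (u ⊗ₜ v) t
      obtain ⟨M', hM'⟩ := hlow (u ⊗ₜ v) s
      refine ⟨max k j, ?_⟩
      convert WeakAssoc.add hM hM' (hk.mono (le_max_left k j)) (hj.mono (le_max_right k j))
        using 1 <;> ext <;> simp
    | tmul u' v' =>
      obtain ⟨k, hk⟩ := h3 u' v
      obtain ⟨T, f, N₀, hf, hq⟩ := (Rop.laurent (v ⊗ₜ u')).exists_decomp
      obtain ⟨L, hL⟩ := exists_weakAssoc_pair hS h1 h2 hf hq u u' v v' w (k := k) fun w => by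
        rw [← mulSubPow'_eq, ← mulSubPow'_eq]
        ext m n
        exact hk w m n
      refine ⟨L, ?_⟩
      have e : (fun a b => tensorYw h1 (𝒯.Y (u ⊗ₜ v) (u' ⊗ₜ v') a) w b)
          = ∑ s ∈ T, scaleNeg (f s) (diag2 (quadIter MU MV u s.1 s.2 v' w)) := by
        ext a b
        rw [h𝒯.2, tensorYw_YRcoef h1 hf hq]
      rw [e]
      exact hL

/-- The `U ⊗_R V`-module structure `u ⊗ v ↦ Y(u,x)Y(v,x)` on `W`. -/
def tensorModule (h𝒯 : IsTwistedTensor 𝒰 𝒱 Rop 𝒯)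
    {Sc : ℤ → (U ⊗[ℂ] V →ₗ[ℂ] V ⊗[ℂ] U)} (hS : ∀ t, IsTensorLaurent fun n => Sc n t)
    (h1 : ∀ (u : U) (v : V) (w : W), IsLaurent2 fun m n => MU.Yw u (MV.Yw v w n) m)
    (h2 : ∀ u v w m n,
      MU.Yw u (MV.Yw v w n) m = twistRHS MV.Yw MU.Yw (fun p => Sc p (u ⊗ₜ v)) w m n)
    (h3 : ∀ (u : U) (v : V), ∃ k : ℕ, ∀ (w : W) (m n : ℤ),
      mulSubPow' k (fun a b => MV.Yw v (MU.Yw u w b) a) m n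
        = mulSubPow' k (twistRHS MU.Yw MV.Yw (fun p => Rop.Rc p (v ⊗ₜ u)) w) m n) :
    NLVAModule 𝒯 W where
  Yw := tensorYw h1
  trunc := tensorYw_isLaurent h1
  vacuum w n := by rw [h𝒯.1, tensorYw_tmul, pairCoef_one_right, MU.vacuum]
  weak_assoc t t' w := by
    obtain ⟨k, hk⟩ := tensorYw_weakAssoc h𝒯 hS h1 h2 h3 t t' w
    exact ⟨k, (weakAssoc_iff _ _ _).1 hk⟩

/-! ### Uniqueness -/

theorem IsTwistedTensor.Y_iotaU_iotaV (h𝒯 : IsTwistedTensor 𝒰 𝒱 Rop 𝒯) (u : U) (v : V) (n : ℤ) :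
    𝒯.Y (iotaU 𝒱 u) (iotaV 𝒰 v) n = 𝒰.Y u 𝒰.one n ⊗ₜ v := by
  have e : 𝒯.Y (iotaU 𝒱 u) (iotaV 𝒰 v) n = YRcoef 𝒰 𝒱 Rop u 𝒱.one 𝒰.one v n := h𝒯.2 _ _ _ _ _
  rw [e, YRcoef_eq (T := {(𝒰.one, 𝒱.one)}) (f := fun _ p => if p = 0 then 1 else 0) (N₀ := 0)
    (fun _ p hp => if_neg hp.ne) fun p => by rw [Rop.vac_right]; simp,
    Finset.sum_singleton, finsum_eq_single _ 0 fun c hc => by simp [hc], tensorDiag,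
    finsum_eq_single _ n fun c hc => by
      rw [𝒱.vacuum_left, if_neg (by omega), TensorProduct.tmul_zero]]
  simp [𝒱.vacuum_left]

theorem mulAddPow_zero_left {Z : ℤ → ℤ → W} (hZ : ∀ a b, a < 0 → Z a b = 0) (k : ℕ) (b : ℤ) :
    mulAddPow k Z 0 b = Z 0 (b - k) := by
  unfold mulAddPow
  rw [Finset.sum_eq_single k]
  · simp
  · intro j hj hjk
    rw [Finset.mem_range] at hj
    rw [hZ _ _ (by omega), smul_zero]
  · simp

theorem substAdd02_zero_left {X : ℤ → ℤ → W} (hX : ∀ a b, a < 0 → X a b = 0) (b : ℤ) :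
    substAdd02 X 0 b = ∑ᶠ p : ℤ, X p (b - p) := by
  unfold substAdd02
  rw [← finsum_comp_of_injective (f := fun p : ℤ => X p (b - p)) Nat.cast_injective]
  · refine finsum_congr fun i => ?_
    simp [zchoose]
  · intro p hp
    refine hX _ _ ?_
    by_contra! h
    exact hp ⟨p.toNat, Int.toNat_of_nonneg h⟩

theorem IsTwistedTensor.module_tmul_eq (h𝒯 : IsTwistedTensor 𝒰 𝒱 Rop 𝒯)
    (h1 : ∀ (u : U) (v : V) (w : W), IsLaurent2 fun m n => MU.Yw u (MV.Yw v w n) m)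
    (M' : NLVAModule 𝒯 W) (hU : ∀ (u : U) (w : W) (n : ℤ), M'.Yw (iotaU 𝒱 u) w n = MU.Yw u w n)
    (hV : ∀ (v : V) (w : W) (n : ℤ), M'.Yw (iotaV 𝒰 v) w n = MV.Yw v w n) (u : U) (v : V)
    (w : W) (n : ℤ) : M'.Yw (u ⊗ₜ v) w n = pairCoef MU.Yw MV.Yw u v w n := by
  obtain ⟨k, hk⟩ := M'.weak_assoc (iotaU 𝒱 u) (iotaV 𝒰 v) w
  simp only [hU, hV, h𝒯.Y_iotaU_iotaV] at hk
  obtain ⟨N, hN⟩ := h1 u v w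
  obtain ⟨K, hkK, hK⟩ : ∃ K : ℕ, k ≤ K ∧ 0 ≤ N + K :=
    ⟨max k (-N).toNat, le_max_left _ _, by omega⟩
  have h := WeakAssoc.mono hkK ((weakAssoc_iff k _ _).2 hk)
  have hlow : LowerBound2 N fun m n => MU.Yw u (MV.Yw v w n) m := fun m n hn => hN m n (Or.inr hn)
  rw [WeakAssoc, ← substAdd02_mulX1_pow hlow, ← mulAddPow_eq] at h
  have h0 := congrFun (congrFun h 0) (n + K)
  rw [mulAddPow_zero_left fun a b ha => by rw [𝒰.creation_reg u a ha]; simp,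
    substAdd02_zero_left fun a b ha => ?_, 𝒰.creation_zero, add_sub_cancel_right] at h0
  · rw [← h0, pairCoef]
    refine Eq.trans ?_ (finsum_comp_equiv (Equiv.subRight (K : ℤ)))
    refine finsum_congr fun p => ?_
    rw [mulX1_pow_apply, Equiv.subRight_apply, sub_sub_eq_add_sub]
  · rw [mulX1_pow_apply]
    exact hN _ _ (Or.inl (by omega))

end TensorModule

/-- Construction of modules for the twisted tensor product from
compatible `U`- and `V`-module structures (Proposition 2.12). -/
theorem statement_10 {U V W : Type*} [AddCommGroup U] [Module ℂ U]
    [AddCommGroup V] [Module ℂ V] [AddCommGroup W] [Module ℂ W]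
    (𝒰 : NLVA U) (𝒱 : NLVA V) (Rop : TwistingOp 𝒰 𝒱)
    (Sc : ℤ → (U ⊗[ℂ] V →ₗ[ℂ] V ⊗[ℂ] U)) (hinv : IsInvPair Rop.Rc Sc)
    (𝒯 : NLVA (U ⊗[ℂ] V)) (h𝒯 : IsTwistedTensor 𝒰 𝒱 Rop 𝒯)
    (MU : NLVAModule 𝒰 W) (MV : NLVAModule 𝒱 W)
    (h1 : ∀ (u : U) (v : V) (w : W),
      IsLaurent2 fun m n => MU.Yw u (MV.Yw v w n) m)
    (h2 : ∀ (u : U) (v : V) (w : W) (m n : ℤ),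
      MU.Yw u (MV.Yw v w n) m
        = twistRHS MV.Yw MU.Yw (fun p => Sc p (u ⊗ₜ v)) w m n)
    (h3 : ∀ (u : U) (v : V), ∃ k : ℕ, ∀ (w : W) (m n : ℤ),
      mulSubPow' k (fun a b => MV.Yw v (MU.Yw u w b) a) m n
        = mulSubPow' k (twistRHS MU.Yw MV.Yw (fun p => Rop.Rc p (v ⊗ₜ u)) w) m n) :
    ∃ M : NLVAModule 𝒯 W,
      (∀ (u : U) (w : W) (n : ℤ), M.Yw (iotaU 𝒱 u) w n = MU.Yw u w n) ∧
      (∀ (v : V) (w : W) (n : ℤ), M.Yw (iotaV 𝒰 v) w n = MV.Yw v w n) ∧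
      ∀ M' : NLVAModule 𝒯 W,
        (∀ (u : U) (w : W) (n : ℤ), M'.Yw (iotaU 𝒱 u) w n = MU.Yw u w n) →
        (∀ (v : V) (w : W) (n : ℤ), M'.Yw (iotaV 𝒰 v) w n = MV.Yw v w n) →
        M'.Yw = M.Yw := by
  refine ⟨tensorModule h𝒯 hinv.1 h1 h2 h3, fun u w n => pairCoef_one_right u w n,
    fun v w n => pairCoef_one_left v w n, fun M' hU hV => ?_⟩
  refine TensorProduct.ext' fun u v => ?_
  ext w n
  exact h𝒯.module_tmul_eq h1 M' hU hV u v w n
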